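/- arXiv:2103.04830 — 9 statements merged into one kernel-verified Lean document; each statement's English description precedes it below -/
import Mathlib

section
/- Let x ∈ ℝⁿ_{≥+} and y ∈ (ℝⁿ_{≥+})*. Then ⟨x,y⟩ = 0 if and only if for every j = 1, …, n−1 one has x_j = x_{j+1} or ∑_{i=1}^{j} yᵢ = 0, and moreover xₙ = 0 or ∑_{i=1}^{n} yᵢ = 0. -/
open Finset RealInnerProductSpace

theorem abel_aux (X Y : ℕ → ℝ) (m : ℕ) : ∑ k ∈ range m, X k * Y k =
    ∑ k ∈ range m, (X k - X (k+1)) * (∑ i ∈ range (k+1), Y i) + X m * ∑ i ∈ range m, Y i := by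
  induction m with
  | zero => simp
  | succ m ih =>
    rw [Finset.sum_range_succ, ih, Finset.sum_range_succ _ m, Finset.sum_range_succ Y m]
    ring

/-- Complementarity in the monotone nonnegative cone: for `x` in the monotone nonnegative cone
`ℝⁿ_{≥+}` and `y` in its dual cone, `⟨x,y⟩ = 0` iff for every `j = 1, …, n-1` one has
`x_j = x_{j+1}` or `∑_{i=1}^j yᵢ = 0`, and moreover `xₙ = 0` or `∑_{i=1}^n yᵢ = 0`. -/
theorem complementarity_monotone_nonneg_cone (n : ℕ) (hn : 0 < n)
    (x y : EuclideanSpace ℝ (Fin n))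
    (hx₁ : ∀ i j : Fin n, i ≤ j → x j ≤ x i)
    (hx₂ : 0 ≤ x ⟨n - 1, by omega⟩)
    (hy : ∀ j : Fin n, 0 ≤ ∑ i ∈ Finset.Iic j, y i) :
    ⟪x, y⟫ = 0 ↔
      (∀ j : ℕ, ∀ hj : j + 1 < n,
          x ⟨j, by omega⟩ = x ⟨j + 1, hj⟩ ∨
            ∑ i ∈ Finset.Iic (⟨j, by omega⟩ : Fin n), y i = 0) ∧
        (x ⟨n - 1, by omega⟩ = 0 ∨ ∑ i, y i = 0) := by
  obtain ⟨X, hX⟩ : ∃ X : ℕ → ℝ, X = fun k => if h : k < n then x ⟨k, h⟩ else 0 := ⟨_, rfl⟩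
  obtain ⟨Y, hY⟩ : ∃ Y : ℕ → ℝ, Y = fun k => if h : k < n then y ⟨k, h⟩ else 0 := ⟨_, rfl⟩
  have hXi : ∀ k (h : k < n), x ⟨k, h⟩ = X k := fun k h => by simp [hX, h]
  have hYi : ∀ i : Fin n, y i = Y i := fun i => by simp [hY]
  have hXn : X n = 0 := by simp [hX]
  have hS : ∀ j (h : j < n), ∑ i ∈ Finset.Iic (⟨j, h⟩ : Fin n), y i = ∑ i ∈ range (j+1), Y i := by
    intro j h
    have e : range (j+1) = (Finset.Iic (⟨j, h⟩ : Fin n)).map Fin.valEmbedding := by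
      rw [Fin.map_valEmbedding_Iic]
      ext a; simp <;> omega
    rw [e, Finset.sum_map]
    exact Finset.sum_congr rfl fun i _ => hYi i
  have hT : ∑ i, y i = ∑ i ∈ range n, Y i := by
    rw [Finset.sum_range]
    exact Finset.sum_congr rfl fun i _ => hYi i
  have hin : ⟪x, y⟫ = ∑ k ∈ range n, X k * Y k := by
    rw [Finset.sum_range, PiLp.inner_apply]
    refine Finset.sum_congr rfl fun i _ => ?_
    rw [← hYi i, ← hXi i i.2]
    simp [mul_comm]
  have hd : ∀ k, k < n → 0 ≤ X k - X (k+1) := by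
    intro k h
    by_cases h' : k + 1 < n
    · have := hx₁ ⟨k, h⟩ ⟨k+1, h'⟩ (by simp)
      rw [hXi, hXi] at this
      linarith
    · obtain rfl : n = k + 1 := by omega
      rw [hXi] at hx₂
      rw [hXn]
      simpa using hx₂
  have hs : ∀ k, k < n → 0 ≤ ∑ i ∈ range (k+1), Y i := fun k h => by
    rw [← hS k h]; exact hy _
  rw [hin, abel_aux, hXn, zero_mul, add_zero, Finset.sum_eq_zero_iff_of_nonneg
    (fun k hk => mul_nonneg (hd k (mem_range.1 hk)) (hs k (mem_range.1 hk)))]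
  simp only [hXi, hS, hT, mul_eq_zero, sub_eq_zero, mem_range]
  obtain ⟨m, rfl⟩ : ∃ m, n = m + 1 := ⟨n - 1, by omega⟩
  simp only [Nat.add_sub_cancel]
  constructor
  · intro H
    refine ⟨fun j hj => H j (by omega), ?_⟩
    have := H m (by omega)
    rwa [hXn] at this
  · rintro ⟨H, H'⟩ k hk
    by_cases h : k = m
    · subst h
      rwa [hXn]
    · exact H k (by omega)
end

section
/- Let p and q be nonnegative integers. The dual cone of the monotone extended second order cone L = {(x,u) ∈ ℝᵖ×ℝᵠ : x₁ ≥ x₂ ≥ ⋯ ≥ x_p ≥ ‖u‖} equals M = {(y,v) ∈ ℝᵖ×ℝᵠ : ∑_{i=1}^{j} yᵢ ≥ 0 for every j = 1, …, p−1, and ∑_{i=1}^{p} yᵢ ≥ ‖v‖}. -/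
open Finset RealInnerProductSpace

/-- The monotone extended second order cone (MESOC)
`L = {(x,u) ∈ ℝᵖ×ℝᵠ : x₁ ≥ x₂ ≥ ⋯ ≥ x_p ≥ ‖u‖}`. -/
def MESOC (p q : ℕ) : Set (EuclideanSpace ℝ (Fin p) × EuclideanSpace ℝ (Fin q)) :=
  {z | (∀ i j : Fin p, i ≤ j → z.1 j ≤ z.1 i) ∧ ∀ i : Fin p, ‖z.2‖ ≤ z.1 i}

theorem abel_aux_s3 : ∀ (p : ℕ) (x y : Fin p → ℝ) (c : ℝ),
    (∀ i j : Fin p, i ≤ j → x j ≤ x i) → (∀ i, c ≤ x i) →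
    (∀ j : Fin p, 0 ≤ ∑ i ∈ Finset.Iic j, y i) → c * ∑ i, y i ≤ ∑ i, x i * y i := by
  intro p
  induction p with
  | zero => intro x y c _ _ _; simp
  | succ n ih =>
    intro x y c hx hc hy
    have h := ih (fun i => x i.castSucc) (fun i => y i.castSucc) (x (Fin.last n))
      (fun i j hij => hx _ _ (by simpa using hij)) (fun i => hx _ _ (Fin.le_last _)) (by
        intro j
        have h1 := hy j.castSucc
        have h2 : Finset.Iic j.castSucc = (Finset.Iic j).map Fin.castSuccEmb := by
          simp
        rw [h2, Finset.sum_map] at h1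
        simpa using h1)
    have h3 := hy (Fin.last n)
    have h4 : Finset.Iic (Fin.last n) = Finset.univ := by
      ext i; simp [Fin.le_last]
    rw [h4] at h3
    have h5 := mul_le_mul_of_nonneg_right (hc (Fin.last n)) h3
    refine h5.trans ?_
    rw [Fin.sum_univ_castSucc, Fin.sum_univ_castSucc, mul_add]
    linarith

/-- The dual cone of the monotone extended second order cone `L` equals
`M = {(y,v) : ∑_{i=1}^j yᵢ ≥ 0 for j = 1, …, p-1, and ∑_{i=1}^p yᵢ ≥ ‖v‖}`. -/
theorem dual_of_MESOC (p q : ℕ) :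
    {w : EuclideanSpace ℝ (Fin p) × EuclideanSpace ℝ (Fin q) |
        ∀ z ∈ MESOC p q, 0 ≤ ⟪z.1, w.1⟫ + ⟪z.2, w.2⟫} =
      {w : EuclideanSpace ℝ (Fin p) × EuclideanSpace ℝ (Fin q) |
        (∀ j : Fin p, (j : ℕ) + 1 < p → 0 ≤ ∑ i ∈ Finset.Iic j, w.1 i) ∧
          ‖w.2‖ ≤ ∑ i, w.1 i} := by
  ext w
  obtain ⟨y, v⟩ := w
  simp only [Set.mem_setOf_eq]
  have key : ∀ x : EuclideanSpace ℝ (Fin p), ⟪x, y⟫ = ∑ i, x i * y i := by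
    intro x
    rw [PiLp.inner_apply]
    exact Finset.sum_congr rfl fun i _ => by simp [mul_comm]
  constructor
  · intro h
    refine ⟨?_, ?_⟩
    · intro j _
      have h1 := h (WithLp.toLp 2 (fun i => if i ≤ j then 1 else 0), 0) (by
        refine ⟨?_, ?_⟩
        · intro a b hab
          by_cases hb : b ≤ j
          · simp [hb, hab.trans hb]
          · simp only [hb, if_false]
            split_ifs <;> norm_num
        · intro i
          simp only [norm_zero]
          split_ifs <;> norm_num)
      simp only [key, inner_zero_left, add_zero, ite_mul, one_mul, zero_mul] at h1
      rw [← Finset.sum_filter] at h1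
      convert h1 using 2
      ext i; simp
    · have h1 := h (WithLp.toLp 2 (fun _ => ‖v‖), -v) (by
        refine ⟨?_, ?_⟩
        · intro a b _; simp
        · intro i; simp)
      have h2 := h (WithLp.toLp 2 (fun _ => 1), 0) (by
        refine ⟨?_, ?_⟩
        · intro a b _; simp
        · intro i; simp)
      simp only [key, inner_zero_left, add_zero, one_mul] at h2
      simp only [key, inner_neg_left, real_inner_self_eq_norm_sq, ← Finset.mul_sum] at h1
      rcases (norm_nonneg v).eq_or_lt with h0 | h0
      · rw [← h0]; exact h2
      · nlinarith
  · rintro ⟨h1, h2⟩ ⟨x, u⟩ ⟨hx, hu⟩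
    simp only at hx hu h1 h2 ⊢
    have h3 := abel_aux_s3 p x y ‖u‖ hx hu (by
      intro j
      by_cases hj : (j : ℕ) + 1 < p
      · exact h1 j hj
      · have h4 : Finset.Iic j = Finset.univ := by
          ext i
          simp only [Finset.mem_Iic, Finset.mem_univ, iff_true, Fin.le_def]
          omega
        rw [h4]
        exact (norm_nonneg v).trans h2)
    have h5 := neg_le_of_abs_le (abs_real_inner_le_norm u v)
    have h6 := mul_le_mul_of_nonneg_left h2 (norm_nonneg u)
    rw [key]
    linarith
end

section
/- Let p, q ≥ 1, let (x,u) ∈ L be in the monotone extended second order cone, let (y,v) ∈ M, and assume u ≠ 0 and v ≠ 0. Then ⟨(x,u),(y,v)⟩ = 0 if and only if (xᵢ − x_{i+1})·∑_{j=1}^{i} y_j = 0 for every i = 1, …, p−1, x_p = ‖u‖, ∑_{i=1}^{p} yᵢ = ‖v‖, and there exists λ > 0 such that v = −λu. -/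
open Finset RealInnerProductSpace

/-- The dual cone `M` of the MESOC, described explicitly. -/
def MESOCdual (p q : ℕ) : Set (EuclideanSpace ℝ (Fin p) × EuclideanSpace ℝ (Fin q)) :=
  {w | (∀ j : Fin p, (j : ℕ) + 1 < p → 0 ≤ ∑ i ∈ Finset.Iic j, w.1 i) ∧
    ‖w.2‖ ≤ ∑ i, w.1 i}

theorem mesoc_abel (X Y : ℕ → ℝ) (n : ℕ) :
    ∑ i ∈ Finset.range (n + 1), X i * Y i =
      X n * ∑ i ∈ Finset.range (n + 1), Y i +
        ∑ i ∈ Finset.range n, (X i - X (i + 1)) * ∑ j ∈ Finset.range (i + 1), Y j := by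
  induction n with
  | zero => simp
  | succ n ih =>
    rw [Finset.sum_range_succ, ih,
      Finset.sum_range_succ (fun i => (X i - X (i + 1)) * ∑ j ∈ Finset.range (i + 1), Y j) n,
      Finset.sum_range_succ (fun i => Y i) (n + 1)]
    ring

theorem mesoc_Iic (p : ℕ) (Y : ℕ → ℝ) (k : Fin p) :
    ∑ j ∈ Finset.Iic k, Y j = ∑ j ∈ Finset.range (k + 1), Y j := by
  refine Finset.sum_bij (fun a _ => (a : ℕ)) ?_ ?_ ?_ ?_
  · intro a ha
    have := Finset.mem_Iic.1 ha
    simp only [Finset.mem_range]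
    have : (a : ℕ) ≤ k := this
    omega
  · intro a _ b _ h
    exact Fin.ext h
  · intro b hb
    have hb := Finset.mem_range.1 hb
    refine ⟨⟨b, by omega⟩, ?_, rfl⟩
    rw [Finset.mem_Iic, Fin.le_def]
    simp only
    omega
  · intros; rfl

/-- Second characterization of the complementarity set of the MESOC: for `(x,u) ∈ L`,
`(y,v) ∈ M` with `u ≠ 0 ≠ v`, one has `⟨(x,u),(y,v)⟩ = 0` iff
`(xᵢ − x_{i+1})·∑_{j=1}^i y_j = 0` for `i = 1, …, p-1`, `x_p = ‖u‖`, `∑ᵢ yᵢ = ‖v‖`,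
and `v = -λu` for some `λ > 0`. -/
theorem mesoc_complementarity_second (p q : ℕ) (hp : 1 ≤ p) (hq : 1 ≤ q)
    (z w : EuclideanSpace ℝ (Fin p) × EuclideanSpace ℝ (Fin q))
    (hz : z ∈ MESOC p q) (hw : w ∈ MESOCdual p q)
    (hu : z.2 ≠ 0) (hv : w.2 ≠ 0) :
    ⟪z.1, w.1⟫ + ⟪z.2, w.2⟫ = 0 ↔
      (∀ i : ℕ, ∀ hi : i + 1 < p,
          (z.1 ⟨i, by omega⟩ - z.1 ⟨i + 1, hi⟩) *
            ∑ j ∈ Finset.Iic (⟨i, by omega⟩ : Fin p), w.1 j = 0) ∧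
        z.1 ⟨p - 1, by omega⟩ = ‖z.2‖ ∧ (∑ i, w.1 i) = ‖w.2‖ ∧
        ∃ l : ℝ, 0 < l ∧ w.2 = -(l • z.2) := by
  obtain ⟨n, rfl⟩ : ∃ n, p = n + 1 := ⟨p - 1, by omega⟩
  obtain ⟨x, u⟩ := z
  obtain ⟨y, v⟩ := w
  obtain ⟨hx, hxu⟩ := hz
  obtain ⟨hy, hyv⟩ := hw
  simp only at hx hxu hy hyv hu hv ⊢
  obtain ⟨X, hX⟩ : ∃ X : ℕ → ℝ, ∀ i : Fin (n + 1), x i = X i :=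
    ⟨fun i => if h : i < n + 1 then x ⟨i, h⟩ else 0, fun i => by beta_reduce; rw [dif_pos i.2]⟩
  obtain ⟨Y, hY⟩ : ∃ Y : ℕ → ℝ, ∀ i : Fin (n + 1), y i = Y i :=
    ⟨fun i => if h : i < n + 1 then y ⟨i, h⟩ else 0, fun i => by beta_reduce; rw [dif_pos i.2]⟩
  have hin : ⟪x, y⟫ = ∑ i ∈ Finset.range (n + 1), X i * Y i := by
    rw [PiLp.inner_apply, ← Fin.sum_univ_eq_sum_range (fun i => X i * Y i)]
    refine Finset.sum_congr rfl fun i _ => ?_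
    simp [hX, hY, mul_comm]
  rw [hin, mesoc_abel]
  simp only [hX, hY, mesoc_Iic, Fin.sum_univ_eq_sum_range (fun i => Y i)] at *
  simp only [Nat.add_sub_cancel]
  have hu0 := norm_pos_iff.2 hu
  have hv0 := norm_pos_iff.2 hv
  have hxn : ‖u‖ ≤ X n := hxu ⟨n, by omega⟩
  have hterm : ∀ i ∈ Finset.range n,
      0 ≤ (X i - X (i + 1)) * ∑ j ∈ Finset.range (i + 1), Y j := by
    intro i hi
    have hi := Finset.mem_range.1 hi
    refine mul_nonneg (sub_nonneg.2 ?_) (hy ⟨i, by omega⟩ (by simpa using hi))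
    exact hx ⟨i, by omega⟩ ⟨i + 1, by omega⟩ (by rw [Fin.le_def]; simp)
  have hT := Finset.sum_nonneg hterm
  have hTz := Finset.sum_eq_zero_iff_of_nonneg hterm
  set S := ∑ j ∈ Finset.range (n + 1), Y j with hS
  set T := ∑ i ∈ Finset.range n, (X i - X (i + 1)) * ∑ j ∈ Finset.range (i + 1), Y j with hTd
  have hcs : -(‖u‖ * ‖v‖) ≤ ⟪u, v⟫ := (abs_le.1 (abs_real_inner_le_norm u v)).1
  have h1 : 0 ≤ (X n - ‖u‖) * S := mul_nonneg (by linarith) (by linarith)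
  have h2 : 0 ≤ ‖u‖ * (S - ‖v‖) := mul_nonneg (by linarith) (by linarith)
  constructor
  · intro h
    have e1 : (X n - ‖u‖) * S = 0 := by nlinarith
    have e2 : ‖u‖ * (S - ‖v‖) = 0 := by nlinarith
    have e3 : T = 0 := by nlinarith
    have e4 : ⟪u, v⟫ = -(‖u‖ * ‖v‖) := by nlinarith
    refine ⟨fun i hi => hTz.1 e3 i (Finset.mem_range.2 (by omega)), ?_, ?_,
      ‖v‖ / ‖u‖, div_pos hv0 hu0, ?_⟩
    · rcases mul_eq_zero.1 e1 with h | h <;> linarith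
    · rcases mul_eq_zero.1 e2 with h | h <;> linarith
    · have e5 : ⟪u, -v⟫ = ‖u‖ * ‖-v‖ := by rw [inner_neg_right, e4, norm_neg, neg_neg]
      have e6 := inner_eq_norm_mul_iff_real.1 e5
      rw [norm_neg] at e6
      rw [div_eq_inv_mul, mul_smul, e6, smul_smul, inv_mul_cancel₀ hu0.ne', one_smul, neg_neg]
  · rintro ⟨c1, c2, c3, l, hl, rfl⟩
    have e3 : T = 0 := hTz.2 fun i hi => c1 i (by have := Finset.mem_range.1 hi; omega)
    rw [e3, c2, c3, norm_neg, norm_smul, inner_neg_right, inner_smul_right,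
      real_inner_self_eq_norm_sq, Real.norm_of_nonneg hl.le]
    ring
end

section
/- A matrix A ∈ ℝ^{p×p} is Lyapunov-like on the monotone nonnegative cone ℝᵖ_{≥+} if and only if there exist real numbers a, a₂, a₃, …, a_p such that A_{ii} = a − ∑_{k=i+1}^{p} a_k for every i = 1, …, p (so A_{pp} = a), A_{ij} = a_j for every i < j, and A_{ij} = 0 for every i > j. -/
open Finset

/-- The monotone nonnegative cone `ℝᵖ_{≥+} = {x : x₁ ≥ x₂ ≥ ⋯ ≥ x_p ≥ 0}`. -/
def monotoneNonnegCone (p : ℕ) : Set (Fin p → ℝ) :=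
  {x | (∀ i j : Fin p, i ≤ j → x j ≤ x i) ∧ ∀ i : Fin p, 0 ≤ x i}

theorem aux_pair {p : ℕ} (x y : Fin p → ℝ) (hx : x ∈ monotoneNonnegCone p)
    (hy : ∀ x' ∈ monotoneNonnegCone p, 0 ≤ ∑ i, x' i * y i)
    (hxy : (∑ i, x i * y i) = 0) (k : Fin p) :
    ∑ i, (if i < k then (x i - x k) * y i else 0) = 0 := by
  obtain ⟨hm, hn⟩ := hx
  have h1 := hy (fun i => max (x i - x k) 0) ⟨fun i j hij => by
    have := hm i j hij
    exact max_le_max (by linarith) le_rfl, fun i => le_max_right _ _⟩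
  have h2 := hy (fun i => min (x i) (x k)) ⟨fun i j hij => by
    exact min_le_min (hm i j hij) le_rfl, fun i => le_min (hn i) (hn k)⟩
  have h3 : (∑ i, max (x i - x k) 0 * y i) + ∑ i, min (x i) (x k) * y i = 0 := by
    rw [← Finset.sum_add_distrib]
    refine Eq.trans ?_ hxy
    refine Finset.sum_congr rfl fun i _ => ?_
    rw [← add_mul]
    congr 1
    rcases le_total (x i) (x k) with h | h
    · rw [max_eq_right (by linarith), min_eq_left h]; ring
    · rw [max_eq_left (by linarith), min_eq_right h]; ring
  have h4 : ∑ i, (if i < k then (x i - x k) * y i else 0) = ∑ i, max (x i - x k) 0 * y i := by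
    refine Finset.sum_congr rfl fun i _ => ?_
    split_ifs with h
    · rw [max_eq_left (by linarith [hm i k h.le])]
    · rw [max_eq_right (by linarith [hm k i (not_lt.mp h)])]; ring
  linarith

theorem aux_mul {p : ℕ} (A : Matrix (Fin p) (Fin p) ℝ) (a : ℝ) (as : Fin p → ℝ)
    (h1 : ∀ i : Fin p, A i i = a - ∑ k ∈ Finset.Ioi i, as k)
    (h2 : ∀ i j : Fin p, i < j → A i j = as j)
    (h3 : ∀ i j : Fin p, j < i → A i j = 0) (x : Fin p → ℝ) (i : Fin p) :
    A.mulVec x i = a * x i - ∑ k, (if i < k then as k * (x i - x k) else 0) := by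
  have e1 : ∑ k ∈ Finset.Ioi i, as k = ∑ k, if i < k then as k else 0 := by
    rw [← Finset.sum_filter]; congr 1; ext; simp
  have e2 : A.mulVec x i = A i i * x i + ∑ k, if i < k then as k * x k else 0 := by
    have : A i i * x i = ∑ k, if i = k then A i k * x k else 0 := by simp
    rw [this, ← Finset.sum_add_distrib]
    simp only [Matrix.mulVec, dotProduct]
    refine Finset.sum_congr rfl fun k _ => ?_
    rcases lt_trichotomy i k with h | h | h
    · simp [h, h.ne, h2 i k h]
    · simp [h]
    · simp [h.ne', h.not_gt, h3 i k h]
  rw [e2, h1, e1, sub_mul, Finset.sum_mul, sub_add, ← Finset.sum_sub_distrib]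
  congr 1
  refine Finset.sum_congr rfl fun k _ => ?_
  split_ifs <;> ring

theorem aux_cone {p : ℕ} (k : ℕ) :
    (fun i : Fin p => if i.val < k then (1 : ℝ) else 0) ∈ monotoneNonnegCone p := by
  refine ⟨fun i j hij => ?_, fun i => ?_⟩
  · have : i.val ≤ j.val := hij
    dsimp only
    split_ifs <;> first | omega | norm_num
  · dsimp only
    split_ifs <;> norm_num

/-- A matrix `A` is Lyapunov-like on the monotone nonnegative cone `ℝᵖ_{≥+}` iff there are
reals `a, a₂, …, a_p` with `A_{ii} = a − ∑_{k=i+1}^p a_k`, `A_{ij} = a_j` for `i < j`,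
and `A_{ij} = 0` for `i > j`. -/
theorem lyapunov_like_monotone_nonneg_cone (p : ℕ) (A : Matrix (Fin p) (Fin p) ℝ) :
    (∀ x y : Fin p → ℝ, x ∈ monotoneNonnegCone p →
        (∀ x' ∈ monotoneNonnegCone p, 0 ≤ ∑ i, x' i * y i) →
        (∑ i, x i * y i) = 0 → (∑ i, A.mulVec x i * y i) = 0) ↔
      ∃ a : ℝ, ∃ as : Fin p → ℝ,
        (∀ i : Fin p, A i i = a - ∑ k ∈ Finset.Ioi i, as k) ∧
        (∀ i j : Fin p, i < j → A i j = as j) ∧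
        (∀ i j : Fin p, j < i → A i j = 0) := by
  constructor
  · intro H
    obtain ⟨P, hP⟩ : ∃ P : Fin p → ℕ → ℝ, ∀ i k, P i k =
      A.mulVec (fun i : Fin p => if i.val < k then (1 : ℝ) else 0) i := ⟨_, fun _ _ => rfl⟩
    have hA : ∀ i j : Fin p, A i j = P i (j.val + 1) - P i j.val := by
      intro i j
      rw [hP, hP]
      simp only [Matrix.mulVec, dotProduct]
      rw [← Finset.sum_sub_distrib, Finset.sum_eq_single j]
      · simp
      · intro b _ hb
        have : b.val ≠ j.val := fun h => hb (Fin.ext h)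
        split_ifs <;> first | omega | simp
      · simp
    have hz : ∀ (i : Fin p) (k : ℕ), k ≤ i.val → P i k = 0 := by
      intro i k hk
      have := H _ (Pi.single i 1) (aux_cone k) (by
        intro x' hx'
        simpa [Pi.single_apply] using hx'.2 i) (by simp [Pi.single_apply, hk])
      simpa [Pi.single_apply, hP] using this
    have he : ∀ (i j : Fin p) (k : ℕ), i < j → j.val < k → P i k = P j k := by
      intro i j k hij hk
      have hij' : i.val < j.val := hij
      have := H _ (Pi.single i 1 - Pi.single j 1) (aux_cone k) (by
        intro x' hx'
        simpa [Pi.single_apply, mul_sub, Finset.sum_sub_distrib] using hx'.1 i j hij.le) (by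
        simp [Pi.single_apply, mul_sub, Finset.sum_sub_distrib, hk, hij'.trans hk])
      simp [Pi.single_apply, mul_sub, Finset.sum_sub_distrib, ← hP] at this
      linarith
    rcases Nat.eq_zero_or_pos p with hp | hp
    · subst hp
      exact ⟨0, 0, fun i => i.elim0, fun i => i.elim0, fun i => i.elim0⟩
    have h0 : ∀ (i : Fin p) (k : ℕ), i.val < k → P i k = P ⟨0, hp⟩ k := by
      intro i k hk
      rcases Nat.eq_zero_or_pos i.val with h | h
      · congr 1; exact Fin.ext h
      · exact (he ⟨0, hp⟩ i k h hk).symm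
    refine ⟨∑ j, A ⟨0, hp⟩ j, A ⟨0, hp⟩, fun i => ?_, fun i j hij => ?_, fun i j hij => ?_⟩
    · rw [hA i i, hz i _ le_rfl, h0 i _ (Nat.lt_succ_self _), hP]
      have : ∑ k ∈ Finset.Ioi i, A ⟨0, hp⟩ k = ∑ k, if i < k then A ⟨0, hp⟩ k else 0 := by
        rw [← Finset.sum_filter]; congr 1; ext; simp
      rw [this, ← Finset.sum_sub_distrib, sub_zero]
      simp only [Matrix.mulVec, dotProduct]
      refine Finset.sum_congr rfl fun k _ => ?_
      have : i < k ↔ i.val < k.val := Iff.rfl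
      simp only [this]
      split_ifs <;> first | omega | simp
    · have hij' : i.val < j.val := hij
      rw [hA i j, hA _ j, h0 i _ hij', h0 i _ (by omega)]
    · have hij' : j.val < i.val := hij
      rw [hA i j, hz i _ (by omega), hz i _ (by omega), sub_zero]
  · rintro ⟨a, as, h1, h2, h3⟩ x y hx hy hxy
    simp only [aux_mul A a as h1 h2 h3, sub_mul, Finset.sum_sub_distrib, mul_assoc,
      ← Finset.mul_sum, hxy, Finset.sum_mul]
    rw [Finset.sum_comm, mul_zero, zero_sub, neg_eq_zero]
    refine Finset.sum_eq_zero fun k _ => ?_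
    have := aux_pair x y hx hy hxy k
    calc _ = as k * ∑ i, (if i < k then (x i - x k) * y i else 0) := by
          rw [Finset.mul_sum]
          refine Finset.sum_congr rfl fun i _ => ?_
          split_ifs <;> ring
      _ = 0 := by rw [this, mul_zero]
end

section
/- Let p, q ≥ 1 and let L be the monotone extended second order cone. Suppose T : ℝᵖ×ℝᵠ → ℝᵖ×ℝᵠ is a Lyapunov-like linear transformation on L with block form T = [[A, B],[C, D]], where A ∈ ℝ^{p×p}, B ∈ ℝ^{p×q}, C ∈ ℝ^{q×p}, D ∈ ℝ^{q×q}. Then for every ((x,u),(y,v)) in the complementarity set C(L) one has ⟨Ax,y⟩ + ⟨Du,v⟩ = 0 and ⟨Bu,y⟩ + ⟨Cx,v⟩ = 0. -/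
open Finset RealInnerProductSpace

/-- If `T = [[A,B],[C,D]]` is Lyapunov-like on the MESOC `L`, then for every
`((x,u),(y,v))` in the complementarity set of `L` one has `⟨Ax,y⟩ + ⟨Du,v⟩ = 0` and
`⟨Bu,y⟩ + ⟨Cx,v⟩ = 0`. -/
theorem mesoc_lyapunov_like_blocks (p q : ℕ) (hp : 1 ≤ p) (hq : 1 ≤ q)
    (A : Matrix (Fin p) (Fin p) ℝ) (B : Matrix (Fin p) (Fin q) ℝ)
    (C : Matrix (Fin q) (Fin p) ℝ) (D : Matrix (Fin q) (Fin q) ℝ)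
    (hT : ∀ z w : EuclideanSpace ℝ (Fin p) × EuclideanSpace ℝ (Fin q),
      z ∈ MESOC p q →
      (∀ z' ∈ MESOC p q, 0 ≤ ⟪z'.1, w.1⟫ + ⟪z'.2, w.2⟫) →
      ⟪z.1, w.1⟫ + ⟪z.2, w.2⟫ = 0 →
      ((∑ i, ((∑ j, A i j * z.1 j) + (∑ j, B i j * z.2 j)) * w.1 i) +
        (∑ i, ((∑ j, C i j * z.1 j) + (∑ j, D i j * z.2 j)) * w.2 i)) = 0) :
    ∀ z w : EuclideanSpace ℝ (Fin p) × EuclideanSpace ℝ (Fin q),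
      z ∈ MESOC p q →
      (∀ z' ∈ MESOC p q, 0 ≤ ⟪z'.1, w.1⟫ + ⟪z'.2, w.2⟫) →
      ⟪z.1, w.1⟫ + ⟪z.2, w.2⟫ = 0 →
      ((∑ i, (∑ j, A i j * z.1 j) * w.1 i) + (∑ i, (∑ j, D i j * z.2 j) * w.2 i)) = 0 ∧
      ((∑ i, (∑ j, B i j * z.2 j) * w.1 i) + (∑ i, (∑ j, C i j * z.1 j) * w.2 i)) = 0 := by
  intro z w hz hw h0
  have h1 := hT z w hz hw h0
  have h2 := hT (z.1, -z.2) (w.1, -w.2) ⟨hz.1, fun i => by simpa using hz.2 i⟩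
    (fun z' hz' => by
      have := hw (z'.1, -z'.2) ⟨hz'.1, fun i => by simpa using hz'.2 i⟩
      simpa using this)
    (by simpa using h0)
  simp only [PiLp.neg_apply, mul_neg, Finset.sum_neg_distrib, add_mul, Finset.sum_add_distrib,
    neg_mul, neg_neg, neg_add_rev] at h1 h2
  constructor <;> linarith
end

section
/- Let p, q ≥ 1 and let L be the monotone extended second order cone. A linear transformation T : ℝᵖ×ℝᵠ → ℝᵖ×ℝᵠ is Lyapunov-like on L if and only if there exist real numbers a, a₂, …, a_p, c₁, …, c_q and a skew-symmetric matrix W ∈ ℝ^{q×q} such that T has block form T = [[A, B],[C, D]], where: A ∈ ℝ^{p×p} satisfies A_{ii} = a − ∑_{k=i+1}^{p} a_k, A_{ij} = a_j for i < j, A_{ij} = 0 for i > j; every one of the p rows of B ∈ ℝ^{p×q} equals (c₁, …, c_q); C ∈ ℝ^{q×p} has its first p−1 columns equal to zero and last column equal to (c₁, …, c_q)ᵀ; and D = a·I_q + W. -/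
open Finset RealInnerProductSpace

lemma mesoc_abel_s9 (n : ℕ) (x w : Fin (n+1) → ℝ) :
    ∑ i, x i * w i = ∑ k : Fin n, (x k.castSucc - x k.succ) * (∑ i ∈ Finset.Iic k.castSucc, w i)
      + x (Fin.last n) * ∑ i, w i := by
  have key : ∀ i, x i = ∑ k : Fin n, (if i ≤ k.castSucc then (x k.castSucc - x k.succ) else 0)
      + x (Fin.last n) := by
    intro i
    induction i using Fin.reverseInduction with
    | last => 
      rw [Finset.sum_eq_zero]; · simp
      intro k _
      rw [if_neg]
      simp [Fin.castSucc_lt_last]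
    | cast j ih =>
      have : ∀ k : Fin n, (if j.castSucc ≤ k.castSucc then (x k.castSucc - x k.succ) else 0)
        = (if j.succ ≤ k.castSucc then (x k.castSucc - x k.succ) else 0) + 
          (if k = j then (x j.castSucc - x j.succ) else 0) := by
        intro k
        simp only [Fin.le_def, Fin.ext_iff, Fin.val_succ, Fin.val_castSucc]
        rcases lt_trichotomy (k:ℕ) j with h | h | h
        · rw [if_neg (by omega), if_neg (by omega), if_neg (by omega)]; simp
        · rw [if_pos (by omega), if_neg (by omega), if_pos (by omega)]
          obtain rfl : k = j := Fin.ext h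
          simp
        · rw [if_pos (by omega), if_pos (by omega), if_neg (by omega)]; simp
      rw [Finset.sum_congr rfl (fun k _ => this k), Finset.sum_add_distrib]
      simp only [Finset.sum_ite_eq', Finset.mem_univ, if_true]
      linarith
  calc ∑ i, x i * w i = ∑ i, ((∑ k : Fin n, (if i ≤ k.castSucc then (x k.castSucc - x k.succ) else 0)
      + x (Fin.last n)) * w i) := Finset.sum_congr rfl (fun i _ => by rw [← key i])
    _ = _ := by
      simp only [add_mul, Finset.sum_add_distrib, Finset.sum_mul, Finset.mul_sum]
      congr 1
      rw [Finset.sum_comm]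
      refine Finset.sum_congr rfl fun k _ => ?_
      have : Finset.Iic k.castSucc = Finset.univ.filter (fun i => i ≤ k.castSucc) := by
        ext; simp
      rw [this, Finset.sum_filter]
      refine Finset.sum_congr rfl fun i _ => ?_
      split_ifs <;> simp

lemma mesoc_bwd (n q : ℕ)
    (A : Matrix (Fin (n+1)) (Fin (n+1)) ℝ) (B : Matrix (Fin (n+1)) (Fin q) ℝ)
    (C : Matrix (Fin q) (Fin (n+1)) ℝ) (W : Matrix (Fin q) (Fin q) ℝ)
    (a : ℝ) (as : Fin (n+1) → ℝ) (c : Fin q → ℝ)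
    (hW : W.transpose = -W)
    (h1 : ∀ i : Fin (n+1), A i i = a - ∑ k ∈ Finset.Ioi i, as k)
    (h2 : ∀ i j : Fin (n+1), i < j → A i j = as j)
    (h3 : ∀ i j : Fin (n+1), j < i → A i j = 0)
    (h4 : ∀ (i : Fin (n+1)) (j : Fin q), B i j = c j)
    (h5 : ∀ (i : Fin q) (j : Fin (n+1)), (j : ℕ) + 1 < n+1 → C i j = 0)
    (h6 : ∀ i : Fin q, C i (Fin.last n) = c i)
    (z w : EuclideanSpace ℝ (Fin (n+1)) × EuclideanSpace ℝ (Fin q))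
    (hz : z ∈ MESOC (n+1) q)
    (hw : ∀ z' ∈ MESOC (n+1) q, 0 ≤ ⟪z'.1, w.1⟫ + ⟪z'.2, w.2⟫)
    (hzw : ⟪z.1, w.1⟫ + ⟪z.2, w.2⟫ = 0) :
      ((∑ i, ((∑ j, A i j * z.1 j) + (∑ j, B i j * z.2 j)) * w.1 i) +
        (∑ i, ((∑ j, C i j * z.1 j) + 
          (∑ j, (a • (1 : Matrix (Fin q) (Fin q) ℝ) + W) i j * z.2 j)) * w.2 i)) = 0 := by
  obtain ⟨x, u⟩ := z
  obtain ⟨v, s⟩ := w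
  obtain ⟨hz1, hz2⟩ := hz
  dsimp only at *
  have inn : ∀ {m : ℕ} (a b : EuclideanSpace ℝ (Fin m)), ⟪a, b⟫ = ∑ i, a i * b i := by
    intro m a b
    simp [PiLp.inner_apply, mul_comm]
  have hS : ∀ k, 0 ≤ ∑ i ∈ Finset.Iic k, v i := by
    intro k
    have := hw (WithLp.toLp 2 (fun i => if i ≤ k then 1 else 0), 0) ⟨?_, ?_⟩
    · simp only [inn] at this
      have e : Finset.Iic k = Finset.univ.filter (fun i => i ≤ k) := by
        ext; simp
      rw [e, Finset.sum_filter]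
      simpa using this
    · intro i j hij
      dsimp only
      split_ifs with h h'
      · simp
      · exact absurd (hij.trans h) h'
      · simp
      · simp
    · intro i
      simp only [norm_zero]
      split_ifs <;> simp
  have hSl : ‖s‖ ≤ ∑ i, v i := by
    have := hw (WithLp.toLp 2 (fun i => ‖s‖), -s) ⟨?_, ?_⟩
    · rw [inn] at this
      simp only [inner_neg_left, real_inner_self_eq_norm_sq, ← Finset.mul_sum] at this
      by_cases h0 : ‖s‖ = 0
      · rw [h0]
        have := hS (Fin.last n)
        have e : Finset.Iic (Fin.last n) = Finset.univ := by ext i; simp [Fin.le_last]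
        rwa [e] at this
      · have hpos : 0 < ‖s‖ := lt_of_le_of_ne (norm_nonneg _) (Ne.symm h0)
        have : 0 ≤ ‖s‖ * (∑ i, v i - ‖s‖) := by nlinarith
        have := nonneg_of_mul_nonneg_right this hpos
        linarith
    · intro i j hij; simp
    · intro i; simp
  have hxl := hz2 (Fin.last n)
  set S := ∑ i, v i with hSdef
  set y := x (Fin.last n) with hy
  have hy0 : 0 ≤ y := (norm_nonneg _).trans hxl
  have hS0 : 0 ≤ S := (norm_nonneg _).trans hSl
  have hterm : ∀ k : Fin n, 0 ≤ (x k.castSucc - x k.succ) * (∑ i ∈ Finset.Iic k.castSucc, v i) := 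
    fun k => mul_nonneg (sub_nonneg.2 (hz1 _ _ (Fin.castSucc_lt_succ).le)) (hS _)
  have hlast : 0 ≤ y * S + ⟪u, s⟫ := by
    have h1 := neg_le_of_abs_le (abs_real_inner_le_norm u s)
    have h2 : ‖u‖ * ‖s‖ ≤ y * S := mul_le_mul hxl hSl (norm_nonneg _) hy0
    linarith
  have hz' := hzw
  rw [inn x v, mesoc_abel_s9 n x v] at hz'
  have hsum0 := Finset.sum_nonneg (fun k (_ : k ∈ Finset.univ) => hterm k)
  have hs0 : ∑ k : Fin n, (x k.castSucc - x k.succ) * (∑ i ∈ Finset.Iic k.castSucc, v i) = 0 := by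
    linarith
  have hl0 : y * S + ⟪u, s⟫ = 0 := by linarith
  have ht0 : ∀ k : Fin n, (x k.castSucc - x k.succ) * (∑ i ∈ Finset.Iic k.castSucc, v i) = 0 := 
    fun k => (Finset.sum_eq_zero_iff_of_nonneg (fun k _ => hterm k)).1 hs0 k (Finset.mem_univ _)
  have hvec : S • u + y • s = 0 := by
    rw [← norm_eq_zero, ← sq_eq_zero_iff]
    refine le_antisymm ?_ (sq_nonneg _)
    rw [norm_add_sq_real, norm_smul, norm_smul, real_inner_smul_left, real_inner_smul_right,
      Real.norm_of_nonneg hS0, Real.norm_of_nonneg hy0]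
    have e1 : S * ‖u‖ ≤ S * y := mul_le_mul_of_nonneg_left hxl hS0
    have e2 : y * ‖s‖ ≤ y * S := mul_le_mul_of_nonneg_left hSl hy0
    have e3 : 0 ≤ S * ‖u‖ := by positivity
    have e4 : 0 ≤ y * ‖s‖ := by positivity
    have e5 : (S * ‖u‖)^2 ≤ (S*y)^2 := by gcongr
    have e6 : (y * ‖s‖)^2 ≤ (y*S)^2 := by gcongr
    have e7 : ⟪u, s⟫ = - (y * S) := by linarith
    rw [e7]
    nlinarith
  have hvi : ∀ i, S * u i + y * s i = 0 := by
    intro i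
    have := congrArg (fun t : EuclideanSpace ℝ (Fin q) => t i) hvec
    simpa using this
  have hskew : ∀ t : Fin q → ℝ, ∑ i, (∑ j, W i j * t j) * t i = 0 := by
    intro t
    have e : ∑ i, (∑ j, W i j * t j) * t i = - ∑ i, (∑ j, W i j * t j) * t i := by
      conv_lhs => simp only [Finset.sum_mul]
      rw [Finset.sum_comm]
      simp only [Finset.sum_mul, ← Finset.sum_neg_distrib]
      refine Finset.sum_congr rfl fun i _ => Finset.sum_congr rfl fun j _ => ?_
      have := congrFun (congrFun hW i) j
      simp only [Matrix.transpose_apply, Matrix.neg_apply] at this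
      rw [this]; ring
    linarith
  have hWus : ∑ i, (∑ j, W i j * u j) * s i = 0 := by
    by_cases h0 : y = 0
    · have : u = 0 := by
        rw [← norm_eq_zero]; exact le_antisymm (by linarith) (norm_nonneg _)
      simp [this]
    · have hs : ∀ i, s i = -(S / y) * u i := by
        intro i
        have := hvi i
        field_simp
        linarith
      calc _ = -(S/y) * ∑ i, (∑ j, W i j * u j) * u i := by
            rw [Finset.mul_sum]
            refine Finset.sum_congr rfl fun i _ => ?_
            rw [hs i]; ring
        _ = 0 := by rw [hskew]; simp
  rw [mesoc_abel_s9 n (fun i => (∑ j, A i j * x j) + ∑ j, B i j * u j)]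
  have hdiff : ∀ k : Fin n, ((∑ j, A k.castSucc j * x j) + ∑ j, B k.castSucc j * u j)
      - ((∑ j, A k.succ j * x j) + ∑ j, B k.succ j * u j) 
      = A k.castSucc k.castSucc * (x k.castSucc - x k.succ) := by
    intro k
    have hB : ∑ j, B k.castSucc j * u j = ∑ j, B k.succ j * u j := by simp [h4]
    rw [hB, add_sub_add_right_eq_sub, ← Finset.sum_sub_distrib]
    have hIoi : Finset.Ioi k.castSucc = insert k.succ (Finset.Ioi k.succ) := by
      ext i; simp only [Finset.mem_Ioi, Finset.mem_insert, Fin.lt_def, Fin.ext_iff, Fin.val_succ, Fin.val_castSucc]; omega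
    have hd : A k.succ k.succ = A k.castSucc k.castSucc + as k.succ := by
      rw [h1, h1, hIoi, Finset.sum_insert (by simp)]; ring
    have hne : k.castSucc ≠ k.succ := (Fin.castSucc_lt_succ).ne
    rw [← Finset.sum_subset (Finset.subset_univ {k.castSucc, k.succ}), Finset.sum_pair hne, hd,
      h2 _ _ Fin.castSucc_lt_succ, h3 _ _ Fin.castSucc_lt_succ]
    · ring
    · intro j _ hj
      simp only [Finset.mem_insert, Finset.mem_singleton, not_or, Fin.ext_iff, Fin.val_succ, Fin.val_castSucc] at hj
      rcases lt_or_ge (j:ℕ) k with h | h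
      · rw [h3 _ _ (by simp [Fin.lt_def]; omega), h3 _ _ (by simp [Fin.lt_def]; omega)]; simp
      · rw [h2 _ _ (by simp [Fin.lt_def]; omega), h2 _ _ (by simp [Fin.lt_def]; omega)]; simp
  rw [Finset.sum_eq_zero (fun k _ => by rw [hdiff, mul_assoc, ht0, mul_zero]), zero_add]
  have hA : ∑ j, A (Fin.last n) j * x j = a * y := by
    rw [Finset.sum_eq_single (Fin.last n)]
    · rw [h1]
      have : Finset.Ioi (Fin.last n) = ∅ := by ext i; simp [Fin.le_last]
      rw [this]; simp [hy]
    · intro j _ hj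
      rw [h3 _ _ (Fin.lt_last_iff_ne_last.2 hj), zero_mul]
    · simp
  have hC : ∀ i, ∑ j, C i j * x j = c i * y := by
    intro i
    rw [Finset.sum_eq_single (Fin.last n)]
    · rw [h6]
    · intro j _ hj
      have := Fin.lt_last_iff_ne_last.2 hj
      rw [h5 _ _ (by simpa [Fin.lt_def] using this), zero_mul]
    · simp
  have hD : ∀ i, ∑ j, (a • (1 : Matrix (Fin q) (Fin q) ℝ) + W) i j * u j = a * u i + ∑ j, W i j * u j := by
    intro i
    simp [add_mul, Finset.sum_add_distrib, Matrix.one_apply]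
  simp only [hA, hC, hD, h4]
  rw [inn] at hl0
  have e1 : ∑ i, (c i * y + (a * u i + ∑ j, W i j * u j)) * s i
      = ∑ i, c i * (y * s i) + a * ∑ i, u i * s i + ∑ i, (∑ j, W i j * u j) * s i := by
    rw [Finset.mul_sum, ← Finset.sum_add_distrib, ← Finset.sum_add_distrib]
    exact Finset.sum_congr rfl fun i _ => by ring
  have e2 : ∑ i, c i * (y * s i) = - ((∑ i, c i * u i) * S) := by
    rw [Finset.sum_mul, ← Finset.sum_neg_distrib]
    refine Finset.sum_congr rfl fun i _ => ?_
    have := hvi i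
    linear_combination c i * this
  rw [e1, hWus, e2]
  linear_combination a * hl0

lemma mesoc_fwd (n q : ℕ) (hq : 1 ≤ q)
    (A : Matrix (Fin (n+1)) (Fin (n+1)) ℝ) (B : Matrix (Fin (n+1)) (Fin q) ℝ)
    (C : Matrix (Fin q) (Fin (n+1)) ℝ) (D : Matrix (Fin q) (Fin q) ℝ)
    (H : ∀ z w : EuclideanSpace ℝ (Fin (n+1)) × EuclideanSpace ℝ (Fin q),
      z ∈ MESOC (n+1) q →
      (∀ z' ∈ MESOC (n+1) q, 0 ≤ ⟪z'.1, w.1⟫ + ⟪z'.2, w.2⟫) →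
      ⟪z.1, w.1⟫ + ⟪z.2, w.2⟫ = 0 →
      ((∑ i, ((∑ j, A i j * z.1 j) + (∑ j, B i j * z.2 j)) * w.1 i) +
        (∑ i, ((∑ j, C i j * z.1 j) + (∑ j, D i j * z.2 j)) * w.2 i)) = 0) :
    ∃ a : ℝ, ∃ as : Fin (n+1) → ℝ, ∃ c : Fin q → ℝ, ∃ W : Matrix (Fin q) (Fin q) ℝ,
      W.transpose = -W ∧
      (∀ i : Fin (n+1), A i i = a - ∑ k ∈ Finset.Ioi i, as k) ∧
      (∀ i j : Fin (n+1), i < j → A i j = as j) ∧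
      (∀ i j : Fin (n+1), j < i → A i j = 0) ∧
      (∀ (i : Fin (n+1)) (j : Fin q), B i j = c j) ∧
      (∀ (i : Fin q) (j : Fin (n+1)), (j : ℕ) + 1 < n+1 → C i j = 0) ∧
      (∀ i : Fin q, C i (Fin.last n) = c i) ∧
      D = a • (1 : Matrix (Fin q) (Fin q) ℝ) + W := by
  -- first family
  have F1 : ∀ (k : Fin n) (x : Fin (n+1) → ℝ) (u : EuclideanSpace ℝ (Fin q)),
      Antitone x → (∀ i, ‖u‖ ≤ x i) → x k.castSucc = x k.succ →
      (∑ j, A k.castSucc j * x j) + (∑ j, B k.castSucc j * u j)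
       = (∑ j, A k.succ j * x j) + (∑ j, B k.succ j * u j) := by
    intro k x u hx hu hk
    have := H (WithLp.toLp 2 x, u) 
      (EuclideanSpace.single k.castSucc 1 - EuclideanSpace.single k.succ 1, 0)
      ⟨fun i j hij => hx hij, hu⟩ ?_ ?_
    · simp only [PiLp.sub_apply, mul_sub, Finset.sum_sub_distrib, PiLp.single_apply] at this
      simp at this
      linarith
    · intro z hz
      simp only [inner_sub_right, EuclideanSpace.inner_single_right]
      have := hz.1 _ _ (Fin.castSucc_lt_succ (i := k)).le
      simp
      linarith
    · simp only [inner_sub_right, EuclideanSpace.inner_single_right]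
      simp [hk]
  have F2 : ∀ (x : Fin (n+1) → ℝ) (u : EuclideanSpace ℝ (Fin q)),
      Antitone x → ‖u‖ = 1 → x (Fin.last n) = 1 →
      (∑ j, A (Fin.last n) j * x j) + (∑ j, B (Fin.last n) j * u j)
       = ∑ i, ((∑ j, C i j * x j) + (∑ j, D i j * u j)) * u i := by
    intro x u hx hu hl
    have := H (WithLp.toLp 2 x, u) 
      (EuclideanSpace.single (Fin.last n) 1, -u)
      ⟨fun i j hij => hx hij, fun i => ?_⟩ ?_ ?_
    · simp only [PiLp.neg_apply, mul_neg, Finset.sum_neg_distrib, PiLp.single_apply] at this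
      simp at this
      linarith
    · rw [hu, ← hl]
      exact hx (Fin.le_last _)
    · intro z hz
      simp only [inner_neg_right, EuclideanSpace.inner_single_right]
      have h1 := hz.2 (Fin.last n)
      have h2 := real_inner_le_norm z.2 u
      rw [hu] at h2
      simp
      linarith
    · simp only [inner_neg_right, EuclideanSpace.inner_single_right, real_inner_self_eq_norm_sq, hu]
      simp [hl]
  -- consequences of the first family
  have anti : ∀ t : ℕ, Antitone (fun i : Fin (n+1) => if (i:ℕ) < t then (1:ℝ) else 0) := by
    intro t i j hij
    have : (i:ℕ) ≤ j := hij
    dsimp only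
    split_ifs <;> first | omega | simp
  have P : ∀ (k : Fin n) (t : ℕ), t ≠ k + 1 →
      ∑ j : Fin (n+1), A k.castSucc j * (if (j:ℕ) < t then (1:ℝ) else 0)
       = ∑ j : Fin (n+1), A k.succ j * (if (j:ℕ) < t then (1:ℝ) else 0) := by
    intro k t ht
    have := F1 k _ 0 (anti t) (fun i => by rw [norm_zero]; split_ifs <;> simp) (by
      simp only [Fin.val_castSucc, Fin.val_succ]
      by_cases h : (k:ℕ) < t
      · rw [if_pos h, if_pos (by omega)]
      · rw [if_neg h, if_neg (by omega)])
    simpa using this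
  have step : ∀ (f : Fin (n+1) → ℝ) (l : Fin (n+1)),
      ∑ j : Fin (n+1), f j * (if (j:ℕ) < (l:ℕ)+1 then (1:ℝ) else 0) =
      ∑ j : Fin (n+1), f j * (if (j:ℕ) < (l:ℕ) then (1:ℝ) else 0) + f l := by
    intro f l
    have : f l = ∑ j, f j * (if j = l then 1 else 0) := by simp
    rw [this, ← Finset.sum_add_distrib]
    refine Finset.sum_congr rfl fun j _ => ?_
    rw [← mul_add]
    congr 1
    simp only [Fin.ext_iff]
    split_ifs <;> first | omega | simp
  have A1 : ∀ (k : Fin n) (l : Fin (n+1)), l ≠ k.castSucc → l ≠ k.succ → 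
      A k.castSucc l = A k.succ l := by
    intro k l hl1 hl2
    simp only [ne_eq, Fin.ext_iff, Fin.val_castSucc, Fin.val_succ] at hl1 hl2
    have e1 := P k l (by omega)
    have e2 := P k (l+1) (by omega)
    rw [step, step] at e2
    linarith
  have rowsum : ∀ k : Fin n, ∑ j, A k.castSucc j = ∑ j, A k.succ j := by
    intro k
    have := F1 k (fun _ => 1) 0 (fun _ _ _ => le_rfl) (by simp) rfl
    simpa using this
  have B1 : ∀ (k : Fin n) (l : Fin q), B k.castSucc l = B k.succ l := by
    intro k l
    have := F1 k (fun _ => 1) (EuclideanSpace.single l 1) (fun _ _ _ => le_rfl) (by simp) rfl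
    simp only [PiLp.single_apply] at this
    simp [rowsum k] at this
    exact this
  -- consequences of the second family
  have G : ∀ (x : Fin (n+1) → ℝ) (u : EuclideanSpace ℝ (Fin q)),
      Antitone x → ‖u‖ = 1 → x (Fin.last n) = 1 →
      (∑ j, A (Fin.last n) j * x j) = ∑ i, (∑ j, D i j * u j) * u i ∧ 
      (∑ j, B (Fin.last n) j * u j) = ∑ i, (∑ j, C i j * x j) * u i := by
    intro x u hx hu hl
    have e1 := F2 x u hx hu hl
    have e2 := F2 x (-u) hx (by simpa using hu) hl
    simp only [PiLp.neg_apply, mul_neg, Finset.sum_neg_distrib, add_mul, neg_mul, neg_neg,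
      Finset.sum_add_distrib] at e1 e2
    constructor <;> linarith
  have i0 : Fin q := ⟨0, hq⟩
  have xs : ∀ t : ℕ, t ≤ n → Antitone (fun i : Fin (n+1) => 1 + if (i:ℕ) < t then (1:ℝ) else 0) := 
    fun t _ => (anti t).const_add 1
  have xl : ∀ t : ℕ, t ≤ n → (fun i : Fin (n+1) => 1 + if (i:ℕ) < t then (1:ℝ) else 0) (Fin.last n) = 1 := by
    intro t ht
    have : ¬ n < t := by omega
    simp [this]
  have A2 : ∀ l : Fin (n+1), (l:ℕ) < n → A (Fin.last n) l = 0 := by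
    intro l hl
    have e1 := (G _ (EuclideanSpace.single i0 1) (xs l hl.le) (by simp) (xl l hl.le)).1
    have e2 := (G _ (EuclideanSpace.single i0 1) (xs (l+1) hl) (by simp) (xl (l+1) hl)).1
    simp only [mul_add, Finset.sum_add_distrib] at e1 e2
    rw [step] at e2
    linarith
  have C2 : ∀ (i : Fin q) (l : Fin (n+1)), (l:ℕ) < n → C i l = 0 := by
    intro i l hl
    have e1 := (G _ (EuclideanSpace.single i 1) (xs l hl.le) (by simp) (xl l hl.le)).2
    have e2 := (G _ (EuclideanSpace.single i 1) (xs (l+1) hl) (by simp) (xl (l+1) hl)).2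
    simp only [mul_add, Finset.sum_add_distrib] at e1 e2
    simp only [step] at e2
    simp only [PiLp.single_apply, mul_ite, mul_one, mul_zero, Finset.sum_ite_eq', 
      Finset.mem_univ, if_true] at e1 e2
    linarith
  have sumlast : ∀ f : Fin (n+1) → ℝ, (∀ l : Fin (n+1), (l:ℕ) < n → f l = 0) → ∑ j, f j = f (Fin.last n) := by
    intro f hf
    rw [Finset.sum_eq_single (Fin.last n)]
    · intro j _ hj
      exact hf j (by simpa [Fin.lt_def] using Fin.lt_last_iff_ne_last.2 hj)
    · simp
  set a := A (Fin.last n) (Fin.last n) with ha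
  have suma : ∑ j, A (Fin.last n) j = a := sumlast _ A2
  have G1 : ∀ (u : EuclideanSpace ℝ (Fin q)), ‖u‖ = 1 → 
      a = ∑ i, (∑ j, D i j * u j) * u i := by
    intro u hu
    have := (G (fun _ => 1) u (fun _ _ _ => le_rfl) hu rfl).1
    simpa [suma] using this
  have BC : ∀ i, B (Fin.last n) i = C i (Fin.last n) := by
    intro i
    have := (G (fun _ => 1) (EuclideanSpace.single i 1) (fun _ _ _ => le_rfl) (by simp) rfl).2
    simp only [PiLp.single_apply] at this
    simpa [sumlast _ (C2 i)] using this
  have Dd : ∀ i, D i i = a := by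
    intro i
    have := G1 (EuclideanSpace.single i 1) (by simp)
    simp only [PiLp.single_apply] at this
    simpa using this.symm
  have Do : ∀ i j, i ≠ j → D i j + D j i = 0 := by
    intro i j hij
    have := G1 (EuclideanSpace.single i (3/5) + EuclideanSpace.single j (4/5)) (by
      rw [← sq_eq_sq₀ (norm_nonneg _) zero_le_one, norm_add_sq_real, 
        EuclideanSpace.inner_single_right]
      simp [hij.symm]
      norm_num)
    simp only [PiLp.add_apply, PiLp.single_apply, mul_add, Finset.sum_add_distrib, mul_ite, mul_zero,
      Finset.sum_ite_eq', Finset.mem_univ, if_true, Dd] at this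
    linarith
  have rows : ∀ i, ∑ j, A i j = a := by
    intro i
    induction i using Fin.reverseInduction with
    | last => exact suma
    | cast k ih => rw [rowsum, ih]
  have low : ∀ i j : Fin (n+1), j < i → A i j = 0 := by
    intro i j
    induction i using Fin.reverseInduction with
    | last => intro h; exact A2 j h
    | cast k ih => 
      intro h
      have h' := h.trans (Fin.castSucc_lt_succ (i := k))
      rw [A1 k j h.ne h'.ne, ih h']
  have up : ∀ i j : Fin (n+1), i < j → A i j = A 0 j := by
    intro i j
    induction i using Fin.induction with
    | zero => intro _; rfl
    | succ k ih => 
      intro h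
      have h' := (Fin.castSucc_lt_succ (i := k)).trans h
      rw [← A1 k j h'.ne' h.ne', ih h']
  refine ⟨a, fun j => A 0 j, fun j => B (Fin.last n) j, D - a • (1 : Matrix (Fin q) (Fin q) ℝ), 
    ?_, ?_, up, low, ?_, ?_, ?_, ?_⟩
  · ext i j
    simp only [Matrix.transpose_apply, Matrix.sub_apply, Matrix.neg_apply, Matrix.smul_apply, Matrix.one_apply, smul_eq_mul]
    by_cases h : i = j
    · subst h; simp [Dd]
    · simp only [h, Ne.symm h, if_false]
      have := Do i j h
      linarith
  · intro i
    have h1 := rows i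
    have h2 : ∑ k ∈ Finset.Ioi i, A 0 k = ∑ k ∈ Finset.Ioi i, A i k := 
      Finset.sum_congr rfl fun k hk => (up i k (Finset.mem_Ioi.1 hk)).symm
    rw [h2]
    have h3 : ∑ k ∈ insert i (Finset.Ioi i), A i k = ∑ k, A i k := by
      refine Finset.sum_subset (Finset.subset_univ _) fun j _ hj => ?_
      simp only [Finset.mem_insert, Finset.mem_Ioi, not_or, not_lt] at hj
      exact low i j (lt_of_le_of_ne hj.2 hj.1)
    rw [Finset.sum_insert (by simp)] at h3
    linarith
  · intro i j
    induction i using Fin.reverseInduction with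
    | last => rfl
    | cast k ih => rw [B1, ih]
  · intro i j hj
    exact C2 i j (by omega)
  · intro i; exact (BC i).symm
  · simp

/-- Characterization of Lyapunov-like transformations on the MESOC: a linear map with block
form `T = [[A,B],[C,D]]` is Lyapunov-like on `L` iff there are reals `a, a₂, …, a_p`,
`c₁, …, c_q` and a skew-symmetric `W` such that `A` is upper triangular with
`A_{ii} = a − ∑_{k=i+1}^p a_k` and `A_{ij} = a_j` for `i < j`, every row of `B` is
`(c₁,…,c_q)`, the first `p-1` columns of `C` vanish and its last column is `(c₁,…,c_q)ᵀ`,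
and `D = a·I + W`. -/
theorem mesoc_lyapunov_like_characterization (p q : ℕ) (hp : 1 ≤ p) (hq : 1 ≤ q)
    (A : Matrix (Fin p) (Fin p) ℝ) (B : Matrix (Fin p) (Fin q) ℝ)
    (C : Matrix (Fin q) (Fin p) ℝ) (D : Matrix (Fin q) (Fin q) ℝ) :
    (∀ z w : EuclideanSpace ℝ (Fin p) × EuclideanSpace ℝ (Fin q),
      z ∈ MESOC p q →
      (∀ z' ∈ MESOC p q, 0 ≤ ⟪z'.1, w.1⟫ + ⟪z'.2, w.2⟫) →
      ⟪z.1, w.1⟫ + ⟪z.2, w.2⟫ = 0 →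
      ((∑ i, ((∑ j, A i j * z.1 j) + (∑ j, B i j * z.2 j)) * w.1 i) +
        (∑ i, ((∑ j, C i j * z.1 j) + (∑ j, D i j * z.2 j)) * w.2 i)) = 0) ↔
    ∃ a : ℝ, ∃ as : Fin p → ℝ, ∃ c : Fin q → ℝ, ∃ W : Matrix (Fin q) (Fin q) ℝ,
      W.transpose = -W ∧
      (∀ i : Fin p, A i i = a - ∑ k ∈ Finset.Ioi i, as k) ∧
      (∀ i j : Fin p, i < j → A i j = as j) ∧
      (∀ i j : Fin p, j < i → A i j = 0) ∧
      (∀ (i : Fin p) (j : Fin q), B i j = c j) ∧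
      (∀ (i : Fin q) (j : Fin p), (j : ℕ) + 1 < p → C i j = 0) ∧
      (∀ i : Fin q, C i ⟨p - 1, by omega⟩ = c i) ∧
      D = a • (1 : Matrix (Fin q) (Fin q) ℝ) + W := by
  obtain ⟨n, rfl⟩ : ∃ n, p = n + 1 := ⟨p - 1, by omega⟩
  constructor
  · intro H
    exact mesoc_fwd n q hq A B C D H
  · rintro ⟨a, as, c, W, hW, h1, h2, h3, h4, h5, h6, rfl⟩ z w hz hw hzw
    exact mesoc_bwd n q A B C W a as c hW h1 h2 h3 h4 h5 h6 z w hz hw hzw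
end

section
/- Let p, q ≥ 1 and let L be the monotone extended second order cone. The set LL(L) of Lyapunov-like linear transformations on L is a linear subspace of the space of (p+q)×(p+q) real matrices of dimension β(L) = p + q(q+1)/2. -/
open Finset RealInnerProductSpace

/-- The space `LL(L)` of Lyapunov-like linear transformations on the MESOC `L`, i.e. linear
maps `T` with `⟨Tz, w⟩ = 0` for all `(z,w)` in the complementarity set of `L`. -/
noncomputable def LyapunovLikeMESOC (p q : ℕ) :
    Submodule ℝ ((EuclideanSpace ℝ (Fin p) × EuclideanSpace ℝ (Fin q)) →ₗ[ℝ]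
      (EuclideanSpace ℝ (Fin p) × EuclideanSpace ℝ (Fin q))) where
  carrier := {T | ∀ z w : EuclideanSpace ℝ (Fin p) × EuclideanSpace ℝ (Fin q),
    z ∈ MESOC p q →
    (∀ z' ∈ MESOC p q, 0 ≤ ⟪z'.1, w.1⟫ + ⟪z'.2, w.2⟫) →
    ⟪z.1, w.1⟫ + ⟪z.2, w.2⟫ = 0 →
    ⟪(T z).1, w.1⟫ + ⟪(T z).2, w.2⟫ = 0}
  add_mem' := by
    intro S T hS hT z w hz hw hzw
    have h1 := hS z w hz hw hzw
    have h2 := hT z w hz hw hzw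
    simp only [LinearMap.add_apply, Prod.fst_add, Prod.snd_add, inner_add_left]
    linarith
  zero_mem' := by
    intro z w _ _ _
    simp
  smul_mem' := by
    intro c T hT z w hz hw hzw
    have h1 := hT z w hz hw hzw
    simp only [LinearMap.smul_apply, Prod.smul_fst, Prod.smul_snd, real_inner_smul_left]
    linear_combination c * h1
  
namespace MesocAux

/-- Monotone coordinates. -/
noncomputable def yc {m : ℕ} (k : Fin (m+1)) : EuclideanSpace ℝ (Fin (m+1)) →ₗ[ℝ] ℝ :=
  Fin.lastCases (motive := fun _ => EuclideanSpace ℝ (Fin (m+1)) →ₗ[ℝ] ℝ)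
    (EuclideanSpace.projₗ (Fin.last m))
    (fun i => EuclideanSpace.projₗ i.castSucc - EuclideanSpace.projₗ i.succ) k

theorem yc_last {m : ℕ} (x : EuclideanSpace ℝ (Fin (m+1))) :
    yc (Fin.last m) x = x (Fin.last m) := by
  simp [yc]

theorem yc_castSucc {m : ℕ} (i : Fin m) (x : EuclideanSpace ℝ (Fin (m+1))) :
    yc i.castSucc x = x i.castSucc - x i.succ := by
  simp [yc]

theorem tele {m : ℕ} (x : EuclideanSpace ℝ (Fin (m+1))) (i : Fin (m+1)) :
    ∑ k, (if i ≤ k then yc k x else 0) = x i := by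
  induction i using Fin.reverseInduction with
  | last =>
    have : ∀ k : Fin (m+1), Fin.last m ≤ k ↔ Fin.last m = k := by
      intro k; exact ⟨fun h => (Fin.last_le_iff.1 h).symm, fun h => h.le⟩
    simp [this, yc_last]
  | cast i ih =>
    have : ∀ k : Fin (m+1), (if i.castSucc ≤ k then yc k x else 0)
        = (if i.castSucc = k then yc k x else 0) + (if i.succ ≤ k then yc k x else 0) := by
      intro k
      by_cases h1 : i.castSucc = k
      · subst h1
        simp
      · have : i.castSucc ≤ k ↔ i.succ ≤ k := by
          simp only [Fin.le_def, Fin.ext_iff, Fin.val_castSucc, Fin.val_succ] at *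
          omega
        simp [h1, this]
    simp_rw [this]
    rw [Finset.sum_add_distrib, ih]
    simp [yc_castSucc]

/-- Generators. -/
noncomputable def gv {m : ℕ} (k : Fin (m+1)) : EuclideanSpace ℝ (Fin (m+1)) :=
  WithLp.toLp 2 (fun i => if i ≤ k then 1 else 0)

@[simp] theorem gv_apply {m : ℕ} (k i : Fin (m+1)) : gv k i = if i ≤ k then (1:ℝ) else 0 := rfl

theorem expand {m : ℕ} (x : EuclideanSpace ℝ (Fin (m+1))) : x = ∑ k, yc k x • gv k := by
  ext i
  rw [← tele x i]
  simp

theorem yc_gv {m : ℕ} (k l : Fin (m+1)) : yc l (gv k) = if l = k then 1 else 0 := by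
  induction l using Fin.lastCases with
  | last =>
    rw [yc_last, gv_apply]
    simp [Fin.last_le_iff, eq_comm]
  | cast i =>
    rw [yc_castSucc, gv_apply, gv_apply]
    simp only [Fin.le_def, Fin.ext_iff, Fin.val_castSucc, Fin.val_succ]
    split_ifs <;> first | omega | norm_num

theorem inner_sum' {n : ℕ} (x y : EuclideanSpace ℝ (Fin n)) : ⟪x, y⟫ = ∑ i, x i * y i := by
  simp [PiLp.inner_apply, mul_comm]

theorem abel_sum {m : ℕ} (f : Fin (m+1) → ℝ) (w : EuclideanSpace ℝ (Fin (m+1))) :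
    ∑ i, (∑ k, if i ≤ k then f k else 0) * w i = ∑ k, f k * ⟪gv k, w⟫ := by
  simp_rw [inner_sum', Finset.sum_mul, Finset.mul_sum]
  rw [Finset.sum_comm]
  refine Finset.sum_congr rfl fun k _ => Finset.sum_congr rfl fun i _ => ?_
  simp

theorem inner_expand {m : ℕ} (x w : EuclideanSpace ℝ (Fin (m+1))) :
    ⟪x, w⟫ = ∑ k, yc k x * ⟪gv k, w⟫ := by
  rw [← abel_sum, inner_sum']
  simp_rw [tele]

theorem gv_mem {m q : ℕ} (k : Fin (m+1)) :
    ((gv k, 0) : EuclideanSpace ℝ (Fin (m+1)) × EuclideanSpace ℝ (Fin q)) ∈ MESOC (m+1) q := by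
  constructor
  · intro i j hij
    simp only [gv_apply]
    split_ifs with h1 h2 <;> first | exact absurd (hij.trans h1) h2 | norm_num
  · intro i
    simp only [gv_apply, norm_zero]
    split_ifs <;> norm_num

theorem one_mem {m q : ℕ} (r : ℝ) (u : EuclideanSpace ℝ (Fin q)) (h : ‖u‖ ≤ r) :
    ((r • gv (Fin.last m), u) : EuclideanSpace ℝ (Fin (m+1)) × EuclideanSpace ℝ (Fin q))
      ∈ MESOC (m+1) q := by
  constructor
  · intro i j hij
    simp [Fin.le_last]
  · intro i
    simpa [Fin.le_last] using h

theorem yc_nonneg {m q : ℕ} {z : EuclideanSpace ℝ (Fin (m+1)) × EuclideanSpace ℝ (Fin q)}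
    (hz : z ∈ MESOC (m+1) q) (k : Fin (m+1)) : 0 ≤ yc k z.1 := by
  induction k using Fin.lastCases with
  | last => rw [yc_last]; exact (norm_nonneg _).trans (hz.2 _)
  | cast i =>
    rw [yc_castSucc]
    have := hz.1 i.castSucc i.succ (Fin.castSucc_lt_succ).le
    linarith

/-- Consequences of complementarity. -/
theorem compl {m q : ℕ} {z w : EuclideanSpace ℝ (Fin (m+1)) × EuclideanSpace ℝ (Fin q)}
    (hz : z ∈ MESOC (m+1) q)
    (hw : ∀ z' ∈ MESOC (m+1) q, 0 ≤ ⟪z'.1, w.1⟫ + ⟪z'.2, w.2⟫)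
    (hzw : ⟪z.1, w.1⟫ + ⟪z.2, w.2⟫ = 0) :
    (∀ i : Fin m, yc i.castSucc z.1 * ⟪gv i.castSucc, w.1⟫ = 0) ∧
    z.1 (Fin.last m) * ⟪gv (Fin.last m), w.1⟫ + ⟪z.2, w.2⟫ = 0 ∧
    z.1 (Fin.last m) • w.2 + ⟪gv (Fin.last m), w.1⟫ • z.2 = 0 := by
  have hW : ∀ k, 0 ≤ ⟪gv k, w.1⟫ := by
    intro k
    simpa using hw _ (gv_mem (q := q) k)
  have hy := yc_nonneg hz
  have hx : ‖z.2‖ ≤ z.1 (Fin.last m) := hz.2 _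
  have hv : ‖w.2‖ ≤ ⟪gv (Fin.last m), w.1⟫ := by
    have := hw _ (one_mem (m := m) ‖w.2‖ (-w.2) (by simp))
    simp only [real_inner_smul_left, inner_neg_left, real_inner_self_eq_norm_sq] at this
    rcases (norm_nonneg w.2).eq_or_lt with h | h
    · rw [← h]; exact hW _
    · nlinarith
  rw [inner_expand, Fin.sum_univ_castSucc, yc_last] at hzw
  set W := ⟪gv (Fin.last m), w.1⟫ with hWd
  set x := z.1 (Fin.last m) with hxd
  have h1 : ∀ i ∈ (Finset.univ : Finset (Fin m)),
      0 ≤ yc i.castSucc z.1 * ⟪gv i.castSucc, w.1⟫ :=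
    fun i _ => mul_nonneg (hy _) (hW _)
  have h2 := Finset.sum_nonneg h1
  have h3 : 0 ≤ x * W + ⟪z.2, w.2⟫ := by
    have a1 := abs_real_inner_le_norm z.2 w.2
    have a2 := neg_abs_le ⟪z.2, w.2⟫
    have a3 : ‖z.2‖ * ‖w.2‖ ≤ x * W :=
      mul_le_mul hx hv (norm_nonneg _) ((norm_nonneg _).trans hx)
    linarith
  have h4 : x * W + ⟪z.2, w.2⟫ = 0 := by linarith
  refine ⟨?_, h4, ?_⟩
  · intro i
    exact (Finset.sum_eq_zero_iff_of_nonneg h1).1 (by linarith) i (Finset.mem_univ _)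
  · rw [← norm_eq_zero, ← sq_eq_zero_iff]
    apply le_antisymm _ (sq_nonneg _)
    rw [norm_add_sq_real, norm_smul, norm_smul, real_inner_smul_left, real_inner_smul_right,
      real_inner_comm, mul_pow, mul_pow, Real.norm_eq_abs, Real.norm_eq_abs, sq_abs, sq_abs]
    have e : ⟪z.2, w.2⟫ = - (x * W) := by linarith
    rw [e]
    have b1 : ‖z.2‖^2 ≤ x^2 := pow_le_pow_left₀ (norm_nonneg _) hx 2
    have b2 : ‖w.2‖^2 ≤ W^2 := pow_le_pow_left₀ (norm_nonneg _) hv 2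
    nlinarith [mul_le_mul_of_nonneg_left b1 (sq_nonneg W),
      mul_le_mul_of_nonneg_left b2 (sq_nonneg x)]

/-- The Lyapunov-like map with prescribed parameters. -/
noncomputable def mk {m q : ℕ} (a : Fin (m+1) → ℝ) (b : EuclideanSpace ℝ (Fin q))
    (S : EuclideanSpace ℝ (Fin q) →ₗ[ℝ] EuclideanSpace ℝ (Fin q)) :
    (EuclideanSpace ℝ (Fin (m+1)) × EuclideanSpace ℝ (Fin q)) →ₗ[ℝ]
      (EuclideanSpace ℝ (Fin (m+1)) × EuclideanSpace ℝ (Fin q)) where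
  toFun z := (∑ k, (a k * yc k z.1) • gv k + ⟪b, z.2⟫ • gv (Fin.last m),
    z.1 (Fin.last m) • b + a (Fin.last m) • z.2 + S z.2)
  map_add' z z' := by
    ext1
    · simp only [Prod.fst_add, Prod.snd_add, map_add, mul_add, add_smul, inner_add_right,
        Finset.sum_add_distrib]
      abel
    · simp only [Prod.fst_add, Prod.snd_add, map_add, add_smul, smul_add, PiLp.add_apply]
      abel
  map_smul' c z := by
    ext1
    · simp only [Prod.smul_fst, Prod.smul_snd, map_smul, real_inner_smul_right, smul_eq_mul,
        smul_add, Finset.smul_sum, smul_smul, RingHom.id_apply]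
      congr 1
      exact Finset.sum_congr rfl fun k _ => by congr 1; ring
    · simp only [Prod.smul_fst, Prod.smul_snd, map_smul, smul_eq_mul, PiLp.smul_apply,
        smul_add, smul_smul, RingHom.id_apply]
      congr 3
      ring

theorem mk_mem {m q : ℕ} (a : Fin (m+1) → ℝ) (b : EuclideanSpace ℝ (Fin q))
    (S : EuclideanSpace ℝ (Fin q) →ₗ[ℝ] EuclideanSpace ℝ (Fin q))
    (hS : ∀ u, ⟪S u, u⟫ = 0) : mk a b S ∈ LyapunovLikeMESOC (m+1) q := by
  intro z w hz hw hzw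
  obtain ⟨h1, h2, h3⟩ := compl hz hw hzw
  have hx : ‖z.2‖ ≤ z.1 (Fin.last m) := hz.2 _
  simp only [mk, LinearMap.coe_mk, AddHom.coe_mk, inner_add_left, sum_inner,
    real_inner_smul_left]
  rw [Fin.sum_univ_castSucc, yc_last]
  have e1 : ∑ i : Fin m, a i.castSucc * yc i.castSucc z.1 * ⟪gv i.castSucc, w.1⟫ = 0 := by
    refine Finset.sum_eq_zero fun i _ => ?_
    rw [mul_assoc, h1, mul_zero]
  have e2 := congrArg (fun t => ⟪b, t⟫) h3
  simp only [inner_add_right, real_inner_smul_right, inner_zero_right] at e2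
  have e3 : ⟪S z.2, w.2⟫ = 0 := by
    have e := congrArg (fun t => ⟪S z.2, t⟫) h3
    simp only [inner_add_right, real_inner_smul_right, inner_zero_right, hS, mul_zero,
      add_zero] at e
    rcases mul_eq_zero.1 e with h | h
    · rw [h] at hx
      have : z.2 = 0 := norm_le_zero_iff.1 hx
      simp [this]
    · exact h
  rw [e1, e3]
  linear_combination a (Fin.last m) * h2 + e2

/-- Parameters of a linear map. -/
noncomputable def par (m q : ℕ) :
    ((EuclideanSpace ℝ (Fin (m+1)) × EuclideanSpace ℝ (Fin q)) →ₗ[ℝ]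
      (EuclideanSpace ℝ (Fin (m+1)) × EuclideanSpace ℝ (Fin q))) →ₗ[ℝ]
    ((Fin (m+1) → ℝ) × ({p : Fin q × Fin q // p.1 ≤ p.2} → ℝ)) where
  toFun T := (fun k => (T (gv k, 0)).1 k, fun p =>
    if p.1.1 = p.1.2 then (T (gv (Fin.last m), 0)).2 p.1.1
    else (T (0, EuclideanSpace.single p.1.1 1)).2 p.1.2)
  map_add' S T := by
    ext p
    · simp
    · simp only [LinearMap.add_apply, Prod.snd_add, PiLp.add_apply, Pi.add_apply]
      split_ifs <;> rfl
  map_smul' c T := by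
    ext p
    · simp
    · simp only [LinearMap.smul_apply, Prod.smul_snd, PiLp.smul_apply, Pi.smul_apply,
        RingHom.id_apply]
      split_ifs <;> rfl

theorem surj (m q : ℕ) (a : Fin (m+1) → ℝ) (c : {p : Fin q × Fin q // p.1 ≤ p.2} → ℝ) :
    ∃ T ∈ LyapunovLikeMESOC (m+1) q, par m q T = (a, c) := by
  let M : Matrix (Fin q) (Fin q) ℝ := fun j i =>
    if h : i < j then c ⟨(i, j), h.le⟩ else if h : j < i then - c ⟨(j, i), h.le⟩ else 0
  have hM : ∀ i j, M i j = - M j i := by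
    intro i j
    rcases lt_trichotomy i j with h | h | h
    · simp [M, h, h.not_gt]
    · simp [M, h]
    · simp [M, h, h.not_gt]
  let b : EuclideanSpace ℝ (Fin q) := WithLp.toLp 2 fun i => c ⟨(i, i), le_rfl⟩
  let S : EuclideanSpace ℝ (Fin q) →ₗ[ℝ] EuclideanSpace ℝ (Fin q) := Matrix.toEuclideanLin M
  have hSa : ∀ u i, S u i = ∑ j, M i j * u j := fun u i => rfl
  have hS : ∀ u, ⟪S u, u⟫ = 0 := by
    intro u
    rw [inner_sum']
    simp_rw [hSa, Finset.sum_mul]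
    have : ∑ i, ∑ j, M i j * u j * u i = - ∑ i, ∑ j, M i j * u j * u i := by
      conv_lhs => rw [Finset.sum_comm]
      simp_rw [← Finset.sum_neg_distrib]
      refine Finset.sum_congr rfl fun k _ => Finset.sum_congr rfl fun i _ => ?_
      rw [hM i k]; ring
    linarith
  refine ⟨mk a b S, mk_mem a b S hS, ?_⟩
  ext p
  · simp [par, mk, yc_gv]
  · obtain ⟨⟨i, j⟩, hij⟩ := p
    by_cases h : i = j
    · subst h
      simp [par, mk, b]
    · have hlt : i < j := lt_of_le_of_ne hij h
      simp [par, mk, h, hSa, Ne.symm h, M, hlt, Pi.single_apply]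

theorem condA {m q : ℕ} {T} (hT : T ∈ LyapunovLikeMESOC (m+1) q)
    {z : EuclideanSpace ℝ (Fin (m+1)) × EuclideanSpace ℝ (Fin q)} (hz : z ∈ MESOC (m+1) q)
    (i : Fin m) (h : z.1 i.castSucc = z.1 i.succ) :
    (T z).1 i.castSucc = (T z).1 i.succ := by
  have := hT z (EuclideanSpace.single i.castSucc 1 - EuclideanSpace.single i.succ 1, 0) hz ?_ ?_
  · simp [inner_sub_right, EuclideanSpace.inner_single_right] at this
    linarith
  · intro z' hz'
    have := hz'.1 i.castSucc i.succ (Fin.castSucc_lt_succ).le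
    simp [inner_sub_right, EuclideanSpace.inner_single_right]
    linarith
  · simp [inner_sub_right, EuclideanSpace.inner_single_right, h]

theorem condB {m q : ℕ} {T} (hT : T ∈ LyapunovLikeMESOC (m+1) q)
    {z : EuclideanSpace ℝ (Fin (m+1)) × EuclideanSpace ℝ (Fin q)} (hz : z ∈ MESOC (m+1) q)
    (r : ℝ) (v : EuclideanSpace ℝ (Fin q)) (hv : ‖v‖ ≤ r)
    (h : z.1 (Fin.last m) * r + ⟪z.2, v⟫ = 0) :
    (T z).1 (Fin.last m) * r + ⟪(T z).2, v⟫ = 0 := by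
  have := hT z (EuclideanSpace.single (Fin.last m) r, v) hz ?_ ?_
  · simp [EuclideanSpace.inner_single_right] at this
    linarith
  · intro z' hz'
    have h1 : ‖z'.2‖ ≤ z'.1 (Fin.last m) := hz'.2 _
    have a1 := abs_real_inner_le_norm z'.2 v
    have a2 := neg_abs_le ⟪z'.2, v⟫
    have a3 : ‖z'.2‖ * ‖v‖ ≤ z'.1 (Fin.last m) * r :=
      mul_le_mul h1 hv (norm_nonneg _) ((norm_nonneg _).trans h1)
    simp [EuclideanSpace.inner_single_right]
    linarith
  · simp [EuclideanSpace.inner_single_right]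
    linarith

theorem inj (m q : ℕ) (T) (hT : T ∈ LyapunovLikeMESOC (m+1) q) (h0 : par m q T = 0) : T = 0 := by
  have ha : ∀ k, (T (gv k, 0)).1 k = 0 := fun k => congrFun (congrArg Prod.fst h0) k
  have hc : ∀ p : {p : Fin q × Fin q // p.1 ≤ p.2},
      (if p.1.1 = p.1.2 then (T (gv (Fin.last m), 0)).2 p.1.1
      else (T (0, EuclideanSpace.single p.1.1 1)).2 p.1.2) = 0 :=
    fun k => congrFun (congrArg Prod.snd h0) k
  have hd : (T (gv (Fin.last m), 0)).2 = 0 := by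
    ext i
    simpa using hc ⟨(i, i), le_rfl⟩
  have hlt : ∀ i j : Fin q, i < j → (T (0, EuclideanSpace.single i 1)).2 j = 0 := by
    intro i j h
    simpa [h.ne] using hc ⟨(i, j), h.le⟩
  have hg : ∀ k, T (gv k, 0) = 0 := by
    intro k
    have hl : (T (gv k, 0)).1 (Fin.last m) = 0 := by
      by_cases hk : k = Fin.last m
      · rw [hk]; exact ha _
      · have := condB hT (gv_mem k) 1 0 (by simp) (by simp [Fin.last_le_iff, hk])
        simpa using this
    ext1
    · ext i
      change (T (gv k, 0)).1 i = 0
      induction i using Fin.reverseInduction with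
      | last => exact hl
      | cast i ih =>
        by_cases hk : i.castSucc = k
        · rw [hk]; exact ha _
        · rw [condA hT (gv_mem k) i, ih]
          have : i.castSucc ≤ k ↔ i.succ ≤ k := by
            simp only [Fin.le_def, Fin.ext_iff, Fin.val_castSucc, Fin.val_succ] at *
            omega
          simp [this]
    · by_cases hk : k = Fin.last m
      · rw [hk]; exact hd
      · ext j
        have := condB hT (gv_mem k) 1 (EuclideanSpace.single j 1) (by simp)
          (by simp [Fin.last_le_iff, hk])
        rw [hl] at this
        simpa [EuclideanSpace.inner_single_right] using this
  have hx : ∀ x, T (x, 0) = 0 := by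
    intro x
    have : ((x, 0) : EuclideanSpace ℝ (Fin (m+1)) × EuclideanSpace ℝ (Fin q))
        = LinearMap.inl ℝ _ _ x := rfl
    rw [this, expand x, map_sum, map_sum]
    refine Finset.sum_eq_zero fun k _ => ?_
    rw [map_smul, map_smul, LinearMap.inl_apply, hg, smul_zero]
  have hsplit : ∀ x u, T (x, u) = T (0, u) := by
    intro x u
    have : ((x, u) : EuclideanSpace ℝ (Fin (m+1)) × EuclideanSpace ℝ (Fin q))
        = (x, 0) + (0, u) := by simp
    rw [this, map_add, hx, zero_add]
  have hneg : ∀ u, T (0, -u) = - T (0, u) := by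
    intro u
    rw [← map_neg]; simp
  have key : ∀ u, (T (0, u)).1 (Fin.last m) * ‖u‖ - ⟪(T (0, u)).2, u⟫ = 0 := by
    intro u
    have := condB hT (one_mem ‖u‖ u le_rfl) ‖u‖ (-u) (by simp)
      (by simp [inner_neg_right]; ring)
    rw [hsplit, inner_neg_right] at this
    linarith
  have key2 : ∀ u, ⟪(T (0, u)).2, u⟫ = 0 ∧ (T (0, u)).1 (Fin.last m) * ‖u‖ = 0 := by
    intro u
    have h1 := key u
    have h2 := key (-u)
    rw [hneg] at h2
    simp at h2
    constructor <;> linarith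
  have h1 : ∀ u, (T (0, u)).1 = 0 := by
    intro u
    ext i
    change (T (0, u)).1 i = 0
    induction i using Fin.reverseInduction with
    | last =>
      rcases mul_eq_zero.1 (key2 u).2 with h | h
      · exact h
      · rw [norm_eq_zero] at h
        rw [h, hx]; simp
    | cast i ih =>
      have := condA hT (one_mem ‖u‖ u le_rfl) i (by simp [Fin.le_last])
      rw [hsplit] at this
      rw [this, ih]
  have hMii : ∀ i, (T (0, EuclideanSpace.single i 1)).2 i = 0 := by
    intro i
    simpa [EuclideanSpace.inner_single_right] using (key2 (EuclideanSpace.single i 1)).1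
  have hM : ∀ i j, (T (0, EuclideanSpace.single i 1)).2 j
      + (T (0, EuclideanSpace.single j 1)).2 i = 0 := by
    intro i j
    have h := (key2 (EuclideanSpace.single i 1 + EuclideanSpace.single j 1)).1
    have e : ((0, EuclideanSpace.single i 1 + EuclideanSpace.single j 1) :
        EuclideanSpace ℝ (Fin (m+1)) × EuclideanSpace ℝ (Fin q))
        = (0, EuclideanSpace.single i 1) + (0, EuclideanSpace.single j 1) := by simp
    rw [e, map_add] at h
    simp [inner_add_right, EuclideanSpace.inner_single_right, hMii] at h
    linarith
  have hM0 : ∀ i, T (0, EuclideanSpace.single i 1) = 0 := by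
    intro i
    ext1
    · exact h1 _
    · ext j
      change (T (0, EuclideanSpace.single i 1)).2 j = 0
      rcases lt_trichotomy i j with h | h | h
      · exact hlt i j h
      · rw [← h]; exact hMii i
      · have := hM i j
        rw [hlt j i h] at this
        linarith
  have hu : ∀ u, T (0, u) = 0 := by
    have : T ∘ₗ LinearMap.inr ℝ _ _ = 0 := by
      apply (EuclideanSpace.basisFun (Fin q) ℝ).toBasis.ext
      intro i
      simpa using hM0 i
    intro u
    exact LinearMap.congr_fun this u
  refine LinearMap.ext fun z => ?_
  obtain ⟨x, u⟩ := z
  rw [hsplit, hu]; rfl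

end MesocAux

/-- The Lyapunov rank of the MESOC: the dimension of the space of Lyapunov-like
transformations on `L` is `β(L) = p + q(q+1)/2`. -/
theorem mesoc_lyapunov_rank (p q : ℕ) (hp : 1 ≤ p) (hq : 1 ≤ q) :
    Module.finrank ℝ (LyapunovLikeMESOC p q) = p + q * (q + 1) / 2 := by
  obtain ⟨m, rfl⟩ : ∃ m, p = m + 1 := ⟨p - 1, by omega⟩
  let f := (MesocAux.par m q).comp (LyapunovLikeMESOC (m+1) q).subtype
  have hf : Function.Bijective f := by
    constructor
    · intro T T' hT
      have h : MesocAux.par m q T.1 = MesocAux.par m q T'.1 := hT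
      have h2 := MesocAux.inj m q (T.1 - T'.1) (Submodule.sub_mem _ T.2 T'.2)
        (by rw [map_sub, h, sub_self])
      exact Subtype.ext (sub_eq_zero.1 h2)
    · rintro ⟨a, c⟩
      obtain ⟨T, hT, h⟩ := MesocAux.surj m q a c
      exact ⟨⟨T, hT⟩, h⟩
  rw [(LinearEquiv.ofBijective f hf).finrank_eq, Module.finrank_prod,
    Module.finrank_fintype_fun_eq_card, Module.finrank_fintype_fun_eq_card, Fintype.card_fin,
    ← Fintype.card_congr (Sym2.sortEquiv (α := Fin q)), Sym2.card, Fintype.card_fin,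
    Nat.choose_two_right, Nat.add_sub_cancel, mul_comm (q + 1)]
end

section
/- Let p ≥ 2 and q ≥ 1, and let L ⊆ ℝᵖ×ℝᵠ be the monotone extended second order cone. Define L₁ = {(t·e, w) : t ≥ 0, w ∈ ℝᵠ, ‖w‖ ≤ t} (the cone generated by {(e, m) : ‖m‖ ≤ 1}, where e = (1,…,1) ∈ ℝᵖ), and L₂ = {∑_{k=1}^{p−1} α_k·(e¹+⋯+e^k, 0) : α_k ≥ 0}, the cone generated by the vectors (1,0,…,0;0,…,0), (1,1,0,…,0;0,…,0), …, (1,…,1,0;0,…,0). Then L = L₁ + L₂ and span(L₁) ∩ span(L₂) = {0}; in particular, L is a reducible cone. -/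
open Finset Pointwise

/-- `L₁ = {(t·e, w) : t ≥ 0, ‖w‖ ≤ t}`, the cone generated by `{(e,m) : ‖m‖ ≤ 1}`. -/
def MESOCpart1 (p q : ℕ) : Set (EuclideanSpace ℝ (Fin p) × EuclideanSpace ℝ (Fin q)) :=
  {z | ∃ t : ℝ, 0 ≤ t ∧ (∀ i : Fin p, z.1 i = t) ∧ ‖z.2‖ ≤ t}

/-- The generator `(e¹ + ⋯ + e^{k+1}, 0)` of `L₂`, for `k = 0, …, p-2`. -/
def MESOCgen (p q : ℕ) (k : Fin (p - 1)) :
    EuclideanSpace ℝ (Fin p) × EuclideanSpace ℝ (Fin q) :=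
  (WithLp.toLp 2 fun i => if (i : ℕ) ≤ (k : ℕ) then 1 else 0, 0)

/-- `L₂`, the cone generated by `(1,0,…,0;0), (1,1,0,…,0;0), …, (1,…,1,0;0)`. -/
def MESOCpart2 (p q : ℕ) : Set (EuclideanSpace ℝ (Fin p) × EuclideanSpace ℝ (Fin q)) :=
  {z | ∃ α : Fin (p - 1) → ℝ, (∀ k, 0 ≤ α k) ∧ z = ∑ k, α k • MESOCgen p q k}

theorem tele_aux (f : ℕ → ℝ) (i n : ℕ) (h : i ≤ n) :
    ∑ k ∈ Finset.range n, (f k - f (k+1)) * (if i ≤ k then (1:ℝ) else 0) = f i - f n := by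
  induction n with
  | zero =>
    obtain rfl : i = 0 := by omega
    simp
  | succ n ih =>
    rw [Finset.sum_range_succ]
    by_cases hi : i ≤ n
    · rw [ih hi, if_pos hi]; ring
    · obtain rfl : i = n + 1 := by omega
      rw [if_neg hi, Finset.sum_eq_zero]
      · ring
      · intro k hk
        rw [Finset.mem_range] at hk
        rw [if_neg (by omega)]; ring

theorem sum_fst (p q : ℕ) (α : Fin (p - 1) → ℝ) (i : Fin p) :
    (∑ k, α k • MESOCgen p q k).1 i
      = ∑ k, α k * (if (i : ℕ) ≤ (k : ℕ) then (1:ℝ) else 0) := by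
  rw [Prod.fst_sum, WithLp.ofLp_sum, Finset.sum_apply]
  rfl

theorem sum_snd (p q : ℕ) (α : Fin (p - 1) → ℝ) :
    (∑ k, α k • MESOCgen p q k).2 = 0 := by
  rw [Prod.snd_sum]
  exact Finset.sum_eq_zero fun k _ => smul_zero (α k)

def span1Aux (p q : ℕ) :
    Submodule ℝ (EuclideanSpace ℝ (Fin p) × EuclideanSpace ℝ (Fin q)) where
  carrier := {z | ∀ i j, z.1 i = z.1 j}
  zero_mem' := by intro i j; rfl
  add_mem' := by
    intro a b ha hb i j
    simp [ha i j, hb i j]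
  smul_mem' := by
    intro c a ha i j
    simp [ha i j]

def span2Aux (p q : ℕ) (l : Fin p) :
    Submodule ℝ (EuclideanSpace ℝ (Fin p) × EuclideanSpace ℝ (Fin q)) where
  carrier := {z | z.1 l = 0 ∧ z.2 = 0}
  zero_mem' := ⟨rfl, rfl⟩
  add_mem' := by
    intro a b ha hb
    exact ⟨by simp [ha.1, hb.1], by simp [ha.2, hb.2]⟩
  smul_mem' := by
    intro c a ha
    exact ⟨by simp [ha.1], by simp [ha.2]⟩

/-- The MESOC is reducible: `L = L₁ + L₂`, where `L₁, L₂ ≠ {0}` are cones whose linear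
spans intersect trivially. -/
theorem mesoc_reducible (p q : ℕ) (hp : 2 ≤ p) (hq : 1 ≤ q) :
    MESOC p q = MESOCpart1 p q + MESOCpart2 p q ∧
    Submodule.span ℝ (MESOCpart1 p q) ⊓ Submodule.span ℝ (MESOCpart2 p q) = ⊥ ∧
    MESOCpart1 p q ≠ {0} ∧ MESOCpart2 p q ≠ {0} := by
  have hlt : p - 1 < p := by omega
  refine ⟨?_, ?_, ?_, ?_⟩
  · ext z
    rw [Set.mem_add]
    constructor
    · rintro ⟨hmono, hn⟩
      let f : ℕ → ℝ := fun i => if h : i < p then z.1 ⟨i, h⟩ else 0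
      have hf : ∀ i : Fin p, f i = z.1 i := fun i => by simp [f]
      have hfl : f (p - 1) = z.1 ⟨p - 1, hlt⟩ := hf ⟨p - 1, hlt⟩
      refine ⟨(WithLp.toLp 2 fun _ => f (p - 1), z.2),
        ⟨f (p - 1), ?_, fun _ => rfl, ?_⟩,
        ∑ k : Fin (p - 1), (f k - f (k + 1)) • MESOCgen p q k,
        ⟨fun k => f k - f (k + 1), ?_, rfl⟩, ?_⟩
      · rw [hfl]; exact (norm_nonneg _).trans (hn _)
      · rw [hfl]; exact hn _
      · intro k
        have hk := k.2
        have h1 := hf ⟨k, by omega⟩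
        have h2 := hf ⟨k + 1, by omega⟩
        have h3 := hmono ⟨k, by omega⟩ ⟨k + 1, by omega⟩ (by simp [Fin.le_def])
        simp only at h1 h2
        simp only [h1, h2]
        linarith
      · refine Prod.ext ?_ ?_
        · ext i
          have := sum_fst p q (fun k => f k - f (k + 1)) i
          simp only at this
          rw [Prod.fst_add, PiLp.add_apply, this,
            Fin.sum_univ_eq_sum_range
              (fun k => (f k - f (k + 1)) * (if (i : ℕ) ≤ k then (1:ℝ) else 0)) (p - 1),
            tele_aux f i (p - 1) (by have := i.2; omega), hf]
          simp
        · have := sum_snd p q (fun k => f k - f (k + 1))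
          rw [Prod.snd_add, this, add_zero]
    · rintro ⟨a, ⟨t, ht, ha, hn⟩, b, ⟨α, hα, rfl⟩, rfl⟩
      constructor
      · intro i j hij
        rw [Prod.fst_add, PiLp.add_apply, PiLp.add_apply, sum_fst, sum_fst, ha, ha]
        gcongr with k
        · exact hα k
        · rw [Fin.le_def] at hij
          split_ifs
          · exact le_rfl
          · omega
          · exact zero_le_one
          · exact le_rfl
      · intro i
        rw [Prod.fst_add, Prod.snd_add, PiLp.add_apply, sum_fst, sum_snd, ha, add_zero]
        have : 0 ≤ ∑ k, α k * (if (i : ℕ) ≤ (k : ℕ) then (1:ℝ) else 0) :=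
          Finset.sum_nonneg fun k _ => mul_nonneg (hα k) (by split_ifs <;> norm_num)
        linarith
  · rw [eq_bot_iff]
    rintro z ⟨h1, h2⟩
    have h1' : z ∈ span1Aux p q := by
      refine Submodule.span_le.2 ?_ h1
      rintro a ⟨t, _, ha, _⟩ i j
      rw [ha, ha]
    have h2' : z ∈ span2Aux p q ⟨p - 1, hlt⟩ := by
      refine Submodule.span_le.2 ?_ h2
      rintro a ⟨α, _, rfl⟩
      refine ⟨?_, sum_snd _ _ _⟩
      rw [sum_fst]
      refine Finset.sum_eq_zero fun k _ => ?_
      have hk := k.2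
      rw [if_neg (by simp only; omega), mul_zero]
    rw [Submodule.mem_bot]
    refine Prod.ext ?_ h2'.2
    ext i
    rw [h1' i ⟨p - 1, hlt⟩, h2'.1]
    rfl
  · intro h
    have hm : ((WithLp.toLp 2 fun _ => 1, 0) :
        EuclideanSpace ℝ (Fin p) × EuclideanSpace ℝ (Fin q)) ∈ MESOCpart1 p q :=
      ⟨1, zero_le_one, fun _ => rfl, by simp⟩
    rw [h, Set.mem_singleton_iff] at hm
    have := congrArg (fun z => z.1 ⟨p - 1, hlt⟩) hm
    simp at this
  · intro h
    have hm : ∑ k, (1:ℝ) • MESOCgen p q k ∈ MESOCpart2 p q :=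
      ⟨fun _ => 1, fun _ => zero_le_one, rfl⟩
    rw [h, Set.mem_singleton_iff] at hm
    have h3 := congrArg (fun z => z.1 ⟨0, by omega⟩) hm
    have h4 := sum_fst p q (fun _ => 1) ⟨0, by omega⟩
    simp only at h3 h4
    rw [h4] at h3
    simp at h3
    omega
end

section
/- Let p, q ≥ 1, let L be the monotone extended second order cone, and let C ⊆ ℝᵠ be a nonempty closed convex set. Then the cylinder K = ℝᵖ×C is an L-isotone projection set; more precisely, P_K(x,u) = (x, P_C(u)) for all (x,u), and whenever (x,u) ≤_L (y,v) one has (x, P_C(u)) ≤_L (y, P_C(v)). -/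
open Finset RealInnerProductSpace

theorem aux_vi {E : Type*} [NormedAddCommGroup E] [InnerProductSpace ℝ E] {C : Set E}
    (hC : Convex ℝ C) {u m : E} (hm : m ∈ C) (h : ∀ c ∈ C, ‖u - m‖ ≤ ‖u - c‖) :
    ∀ c ∈ C, inner ℝ (u - m) (c - m) ≤ 0 := by
  refine (norm_eq_iInf_iff_real_inner_le_zero hC hm).1 ?_
  haveI : Nonempty C := ⟨⟨m, hm⟩⟩
  refine le_antisymm (le_ciInf fun c => h c c.2) ?_
  exact ciInf_le (f := fun c : C => ‖u - c‖)
    ⟨0, by rintro _ ⟨c, rfl⟩; exact norm_nonneg _⟩ ⟨m, hm⟩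

theorem aux_ne {E : Type*} [NormedAddCommGroup E] [InnerProductSpace ℝ E] {C : Set E}
    (hC : Convex ℝ C) {u m v n : E} (hm : m ∈ C) (h : ∀ c ∈ C, ‖u - m‖ ≤ ‖u - c‖)
    (hn : n ∈ C) (h' : ∀ c ∈ C, ‖v - n‖ ≤ ‖v - c‖) : ‖m - n‖ ≤ ‖u - v‖ := by
  have h1 := aux_vi hC hm h n hn
  have h2 := aux_vi hC hn h' m hm
  have h3 : inner ℝ (u - m) (n - m) + inner ℝ (v - n) (m - n)
      = inner ℝ (m - n) (m - n) - inner ℝ (u - v) (m - n) := by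
    simp only [inner_sub_left, inner_sub_right]
    ring
  have h4 := real_inner_le_norm (u - v) (m - n)
  rw [real_inner_self_eq_norm_sq] at h3
  by_contra hlt
  push Not at hlt
  nlinarith [norm_nonneg (u - v), norm_nonneg (m - n)]

/-- The cylinder `K = ℝᵖ×C` over a nonempty closed convex set `C` is an MESOC-isotone
projection set: the metric projection onto `K` is `P_K(x,u) = (x, P_C u)` and it is
isotone with respect to the order induced by the MESOC `L`. -/
theorem cylinder_is_mesoc_isotone_projection_set (p q : ℕ) (hp : 1 ≤ p) (hq : 1 ≤ q)
    (C : Set (EuclideanSpace ℝ (Fin q)))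
    (hCne : C.Nonempty) (hCcl : IsClosed C) (hCcv : Convex ℝ C)
    (PC : EuclideanSpace ℝ (Fin q) → EuclideanSpace ℝ (Fin q))
    (hPC : ∀ u, PC u ∈ C ∧ ∀ c ∈ C, ‖u - PC u‖ ≤ ‖u - c‖)
    (PK : EuclideanSpace ℝ (Fin p) × EuclideanSpace ℝ (Fin q) →
      EuclideanSpace ℝ (Fin p) × EuclideanSpace ℝ (Fin q))
    (hPK : ∀ z, (PK z).2 ∈ C ∧
      ∀ w : EuclideanSpace ℝ (Fin p) × EuclideanSpace ℝ (Fin q), w.2 ∈ C →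
        ‖z.1 - (PK z).1‖ ^ 2 + ‖z.2 - (PK z).2‖ ^ 2 ≤ ‖z.1 - w.1‖ ^ 2 + ‖z.2 - w.2‖ ^ 2) :
    (∀ z, PK z = (z.1, PC z.2)) ∧
    (∀ z w : EuclideanSpace ℝ (Fin p) × EuclideanSpace ℝ (Fin q),
      w - z ∈ MESOC p q → PK w - PK z ∈ MESOC p q) ∧
    (∀ z w : EuclideanSpace ℝ (Fin p) × EuclideanSpace ℝ (Fin q),
      w - z ∈ MESOC p q → ((w.1, PC w.2) - (z.1, PC z.2) :
        EuclideanSpace ℝ (Fin p) × EuclideanSpace ℝ (Fin q)) ∈ MESOC p q) := by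
  have key : ∀ z w : EuclideanSpace ℝ (Fin p) × EuclideanSpace ℝ (Fin q),
      w - z ∈ MESOC p q → ((w.1, PC w.2) - (z.1, PC z.2) :
        EuclideanSpace ℝ (Fin p) × EuclideanSpace ℝ (Fin q)) ∈ MESOC p q := by
    rintro z w ⟨h1, h2⟩
    refine ⟨h1, fun i => le_trans ?_ (h2 i)⟩
    exact aux_ne hCcv (hPC w.2).1 (hPC w.2).2 (hPC z.2).1 (hPC z.2).2
  have eq : ∀ z, PK z = (z.1, PC z.2) := by
    intro z
    obtain ⟨hz, hmin⟩ := hPK z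
    have a := hmin (z.1, PC z.2) (hPC z.2).1
    have b := (hPC z.2).2 _ hz
    simp only [sub_self, norm_zero] at a
    have b2 := pow_le_pow_left₀ (norm_nonneg _) b 2
    have c : ‖z.1 - (PK z).1‖ = 0 := by
      have : ‖z.1 - (PK z).1‖ ^ 2 = 0 := by
        nlinarith [sq_nonneg ‖z.1 - (PK z).1‖]
      exact pow_eq_zero_iff (two_ne_zero) |>.1 this
    have d : ‖z.2 - (PK z).2‖ ≤ ‖z.2 - PC z.2‖ := by
      refine (sq_le_sq₀ (norm_nonneg _) (norm_nonneg _)).1 ?_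
      nlinarith [sq_nonneg ‖z.1 - (PK z).1‖]
    have e := aux_ne hCcv hz (fun x hx => d.trans ((hPC z.2).2 x hx))
      (hPC z.2).1 (hPC z.2).2
    rw [sub_self, norm_zero] at e
    refine Prod.ext (sub_eq_zero.1 (norm_eq_zero.1 c)).symm ?_
    exact sub_eq_zero.1 (norm_le_zero_iff.1 e)
  refine ⟨eq, fun z w h => ?_, key⟩
  rw [eq, eq]
  exact key z w h
end
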